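/- arXiv:1011.0517 — 3 statements merged into one kernel-verified Lean document; each statement's English description precedes it below -/
import Mathlib

section
/- Every set of 9 points in the plane in general position contains a 5-hole or an empty 7-pseudo-triangle. -/
open Set

noncomputable section

/-- Points of the plane. -/
abbrev Pt : Type := ℝ × ℝ

/-- Two-dimensional cross product. -/
def cross2 (u w : Pt) : ℝ := u.1 * w.2 - u.2 * w.1

/-- A set of points is in general position if no three of its points are collinear. -/
def GenPos (S : Set Pt) : Prop :=
  ∀ p ∈ S, ∀ q ∈ S, ∀ r ∈ S, p ≠ q → p ≠ r → q ≠ r →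
    ¬ Collinear ℝ ({p, q, r} : Set Pt)

/-- `v : ZMod n → Pt` lists the vertices (in cyclic order) of a simple polygon:
vertices are pairwise distinct, non-adjacent edges are disjoint, and adjacent
edges meet exactly in their common vertex. -/
structure IsSimplePolygon (n : ℕ) (v : ZMod n → Pt) : Prop where
  three_le : 3 ≤ n
  inj : Function.Injective v
  nonadj : ∀ i j : ZMod n, i ≠ j → i ≠ j + 1 → j ≠ i + 1 →
    segment ℝ (v i) (v (i + 1)) ∩ segment ℝ (v j) (v (j + 1)) = ∅
  adj : ∀ i : ZMod n,
    segment ℝ (v i) (v (i + 1)) ∩ segment ℝ (v (i + 1)) (v (i + 2)) = {v (i + 1)}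

/-- Twice the signed area of a polygon. -/
def signedArea (n : ℕ) (v : ZMod n → Pt) : ℝ :=
  if h : n = 0 then 0 else
    haveI : NeZero n := ⟨h⟩
    ∑ i : ZMod n, cross2 (v i) (v (i + 1))

/-- The turning cross product at vertex `i`. -/
def vtxCross (n : ℕ) (v : ZMod n → Pt) (i : ZMod n) : ℝ :=
  cross2 (v i - v (i - 1)) (v (i + 1) - v i)

/-- Vertex `i` of a simple polygon is convex (interior angle `< π`) iff the turn
at `i` has the same (strict) sign as the orientation of the polygon. -/
def IsConvexVtx (n : ℕ) (v : ZMod n → Pt) (i : ZMod n) : Prop :=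
  0 < vtxCross n v i * signedArea n v

/-- A pseudo-triangle: a simple polygon in which every vertex is strictly convex or
strictly reflex, with exactly three convex vertices. -/
def IsPseudoTriangle (n : ℕ) (v : ZMod n → Pt) : Prop :=
  IsSimplePolygon n v ∧ (∀ i : ZMod n, vtxCross n v i ≠ 0) ∧
    {i : ZMod n | IsConvexVtx n v i}.ncard = 3

/-- A standard pseudo-triangle: each of the three side chains has at least two
edges, i.e. no two convex vertices are cyclically adjacent. -/
def IsStandardPseudoTriangle (n : ℕ) (v : ZMod n → Pt) : Prop :=
  IsPseudoTriangle n v ∧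
    ∀ i : ZMod n, IsConvexVtx n v i → ¬ IsConvexVtx n v (i + 1)

/-- A mountain: a pseudo-triangle in which exactly one side chain consists of a
single edge (i.e. exactly one cyclically adjacent pair of convex vertices);
a 3-mountain is a triangle. -/
def IsMountain (n : ℕ) (v : ZMod n → Pt) : Prop :=
  IsPseudoTriangle n v ∧
    (n = 3 ∨ {i : ZMod n | IsConvexVtx n v i ∧ IsConvexVtx n v (i + 1)}.ncard = 1)

/-- The boundary of a polygon: the union of its edges. -/
def polyBoundary (n : ℕ) (v : ZMod n → Pt) : Set Pt :=
  ⋃ i : ZMod n, segment ℝ (v i) (v (i + 1))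

/-- The interior of a simple polygon: the union of the bounded connected
components of the complement of its boundary. -/
def polyInterior (n : ℕ) (v : ZMod n → Pt) : Set Pt :=
  {x : Pt | x ∉ polyBoundary n v ∧
    Bornology.IsBounded (connectedComponentIn (polyBoundary n v)ᶜ x)}

/-- A polygon is empty in `S` if its interior contains no point of `S`. -/
def EmptyIn (n : ℕ) (v : ZMod n → Pt) (S : Set Pt) : Prop :=
  polyInterior n v ∩ S = ∅

/-- `S` contains an empty `ℓ`-pseudo-triangle. -/
def HasEmptyPseudoTriangle (ℓ : ℕ) (S : Set Pt) : Prop :=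
  ∃ v : ZMod ℓ → Pt, Set.range v ⊆ S ∧ IsPseudoTriangle ℓ v ∧ EmptyIn ℓ v S

/-- A set of points is in convex position if each of them is a vertex of their
convex hull. -/
def ConvexPos (H : Set Pt) : Prop := ∀ p ∈ H, p ∉ convexHull ℝ (H \ {p})

/-- `H` is a `k`-hole in `S`: `k` points of `S` in convex position whose convex
hull contains no other point of `S` in its interior. -/
def IsHole (k : ℕ) (S H : Set Pt) : Prop :=
  H ⊆ S ∧ H.ncard = k ∧ ConvexPos H ∧
    ∀ p ∈ S, p ∈ interior (convexHull ℝ H) → p ∈ H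

/-- `S` contains a `k`-hole. -/
def HasHole (k : ℕ) (S : Set Pt) : Prop := ∃ H : Set Pt, IsHole k S H

/-- The points of `S` that are vertices of the convex hull of `S`. -/
def hullVertices (S : Set Pt) : Set Pt := {p ∈ S | p ∉ convexHull ℝ (S \ {p})}

/-- The points of `S` lying in the interior of the convex hull of `S`. -/
def interiorPts (S : Set Pt) : Set Pt := {p ∈ S | p ∈ interior (convexHull ℝ S)}

/-- `S` is `λ`-convex: every triangle with vertices in `S` contains at most `λ`
points of `S` in its interior. -/
def LambdaConvex (lam : ℕ) (S : Set Pt) : Prop :=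
  ∀ p ∈ S, ∀ q ∈ S, ∀ r ∈ S,
    (S ∩ interior (convexHull ℝ ({p, q, r} : Set Pt))).ncard ≤ lam

namespace NinePts

/-- Orientation of a triple of points (twice the signed area). -/
def tri (p q r : Pt) : ℝ := cross2 (q - p) (r - p)

lemma tri_def (p q r : Pt) :
    tri p q r = (q.1 - p.1) * (r.2 - p.2) - (q.2 - p.2) * (r.1 - p.1) := by
  simp [tri, cross2]

lemma tri_rot (p q r : Pt) : tri q r p = tri p q r := by
  simp only [tri_def]; ring

lemma tri_rot' (p q r : Pt) : tri r p q = tri p q r := by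
  simp only [tri_def]; ring

lemma tri_swap (p q r : Pt) : tri q p r = - tri p q r := by
  simp only [tri_def]; ring

lemma tri_swap' (p q r : Pt) : tri p r q = - tri p q r := by
  simp only [tri_def]; ring

lemma tri_swap'' (p q r : Pt) : tri r q p = - tri p q r := by
  simp only [tri_def]; ring

@[simp] lemma tri_left (p q : Pt) : tri p q p = 0 := by simp only [tri_def]; ring
@[simp] lemma tri_right (p q : Pt) : tri p q q = 0 := by simp only [tri_def]; ring
@[simp] lemma tri_same (p q : Pt) : tri p p q = 0 := by simp only [tri_def]; ring

lemma tri_comb (p q x y : Pt) (s t : ℝ) (h : s + t = 1) :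
    tri p q (s • x + t • y) = s * tri p q x + t * tri p q y := by
  have ht : t = 1 - s := by linarith
  subst ht
  simp only [tri_def, Prod.fst_add, Prod.snd_add, Prod.smul_fst, Prod.smul_snd, smul_eq_mul]
  ring

lemma tri_add_smul (p q x y z : Pt) (t : ℝ) :
    tri p q (x + t • (y - z)) = tri p q x + t * (tri p q y - tri p q z) := by
  simp only [tri_def, Prod.fst_add, Prod.snd_add, Prod.smul_fst, Prod.smul_snd, smul_eq_mul,
    Prod.fst_sub, Prod.snd_sub]
  ring

lemma convex_pos (p q : Pt) : Convex ℝ {x | 0 < tri p q x} := by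
  intro x hx y hy s t hs ht h
  simp only [mem_ofPred_eq] at *
  rw [tri_comb _ _ _ _ _ _ h]
  rcases hs.eq_or_lt with rfl | hs
  · have : t = 1 := by linarith
    subst this; simpa using hy
  · nlinarith [mul_pos hs hx, mul_nonneg ht hy.le]

lemma convex_nonneg (p q : Pt) : Convex ℝ {x | 0 ≤ tri p q x} := by
  intro x hx y hy s t hs ht h
  simp only [mem_ofPred_eq] at *
  rw [tri_comb _ _ _ _ _ _ h]
  positivity

/-- A point of general position gives nonzero orientations. -/
lemma tri_ne_zero {S : Set Pt} (h : GenPos S) {p q r : Pt} (hp : p ∈ S) (hq : q ∈ S) (hr : r ∈ S)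
    (hpq : p ≠ q) (hpr : p ≠ r) (hqr : q ≠ r) : tri p q r ≠ 0 := by
  intro h0
  apply h p hp q hq r hr hpq hpr hqr
  rw [collinear_iff_of_mem (p₀ := p) (by simp)]
  refine ⟨q - p, ?_⟩
  rw [tri_def] at h0
  have key : ∃ t : ℝ, r = t • (q - p) +ᵥ p := by
    by_cases h1 : q.1 - p.1 = 0
    · have h2 : q.2 - p.2 ≠ 0 := by
        intro h2
        exact hpq (Prod.ext (by linarith) (by linarith))
      refine ⟨(r.2 - p.2) / (q.2 - p.2), ?_⟩
      have h3 : r.1 - p.1 = 0 := by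
        rw [h1] at h0
        have : (q.2 - p.2) * (r.1 - p.1) = 0 := by linarith
        exact (mul_eq_zero.mp this).resolve_left h2
      ext
      · simp [h1]; linarith
      · simp; field_simp; ring
    · refine ⟨(r.1 - p.1) / (q.1 - p.1), ?_⟩
      ext
      · simp; field_simp; ring
      · simp; field_simp; linarith
  intro x hx
  simp only [mem_insert_iff, mem_singleton_iff] at hx
  rcases hx with rfl | rfl | rfl
  · exact ⟨0, by simp⟩
  · exact ⟨1, by simp⟩
  · exact key

/-- Two segments weakly / strictly separated by a line are disjoint. -/
lemma seg_disj (p q a b c d : Pt) (ha : 0 < tri p q a) (hb : 0 < tri p q b)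
    (hc : tri p q c ≤ 0) (hd : tri p q d ≤ 0) : segment ℝ a b ∩ segment ℝ c d = ∅ := by
  rw [eq_empty_iff_forall_notMem]
  rintro x ⟨h1, h2⟩
  have e1 : 0 < tri p q x := (convex_pos p q).segment_subset ha hb h1
  have e2 : 0 ≤ tri q p x :=
    (convex_nonneg q p).segment_subset (by simp only [mem_ofPred_eq]; rw [tri_swap]; linarith)
      (by simp only [mem_ofPred_eq]; rw [tri_swap]; linarith) h2
  rw [tri_swap] at e2
  linarith

lemma seg_adj (a b c : Pt) (h : tri a b c ≠ 0) :
    segment ℝ a b ∩ segment ℝ b c = {b} := by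
  apply Subset.antisymm
  · rintro x ⟨h1, h2⟩
    obtain ⟨s, t, hs, ht, hst, rfl⟩ := h2
    have h0 : tri a b (s • b + t • c) = 0 := by
      obtain ⟨u, w, hu, hw, huw, e⟩ := h1
      rw [← e, tri_comb _ _ _ _ _ _ huw]; simp
    rw [tri_comb _ _ _ _ _ _ hst] at h0
    have : t = 0 := by simpa [h] using h0
    subst this
    have : s = 1 := by linarith
    subst this
    simp
  · rintro x rfl
    exact ⟨right_mem_segment ℝ _ _, left_mem_segment ℝ _ _⟩

/-- A point in an unbounded convex set avoiding the boundary is not interior. -/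
lemma not_interior {n : ℕ} {v : ZMod n → Pt} {q : Pt} (K : Set Pt) (hK : Convex ℝ K) (hq : q ∈ K)
    (d : Pt) (hd : d ≠ 0) (hrec : ∀ t : ℝ, 0 ≤ t → q + t • d ∈ K)
    (hdis : ∀ i, ∀ x ∈ segment ℝ (v i) (v (i + 1)), x ∉ K) : q ∉ polyInterior n v := by
  rintro ⟨-, hb⟩
  have hsub : K ⊆ (polyBoundary n v)ᶜ := by
    intro x hx hx'
    simp only [polyBoundary, mem_iUnion] at hx'
    obtain ⟨i, hi⟩ := hx'
    exact hdis i x hi hx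
  have hKc := hK.isPreconnected.subset_connectedComponentIn hq hsub
  have hbK := hb.subset hKc
  obtain ⟨C, hC⟩ := hbK.exists_norm_le
  have hdn : 0 < ‖d‖ := norm_pos_iff.mpr hd
  have hCq := hC q hq
  have hC0 : 0 ≤ C := (norm_nonneg _).trans hCq
  set t : ℝ := (2 * C + 1) / ‖d‖ with ht
  have ht0 : 0 ≤ t := by positivity
  have h1 := hC _ (hrec t ht0)
  have h2 : ‖t • d‖ ≤ ‖q + t • d‖ + ‖q‖ := by
    calc ‖t • d‖ = ‖(q + t • d) - q‖ := by congr 1; abel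
      _ ≤ _ := norm_sub_le _ _
  rw [norm_smul, Real.norm_of_nonneg ht0, ht, div_mul_cancel₀ _ hdn.ne'] at h2
  linarith

/-- A point separated by a line from all vertices is not interior. -/
lemma not_interior_far {n : ℕ} {v : ZMod n → Pt} {q a b : Pt} (hq : 0 < tri a b q)
    (hv : ∀ i, tri a b (v i) ≤ 0) : q ∉ polyInterior n v := by
  have hab : b - a ≠ 0 := by
    intro h
    rw [sub_eq_zero] at h
    subst h
    simp at hq
  refine not_interior {x | 0 < tri a b x} (convex_pos a b) hq (b - a) hab ?_ ?_
  · intro t _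
    simp only [mem_ofPred_eq, tri_add_smul]
    simpa using hq
  · intro i x hx hx'
    have := (convex_nonneg b a).segment_subset (x := v i) (y := v (i + 1))
      (by simp only [mem_ofPred_eq]; rw [tri_swap]; linarith [hv i])
      (by simp only [mem_ofPred_eq]; rw [tri_swap]; linarith [hv (i+1)]) hx
    simp only [mem_ofPred_eq] at this hx'
    rw [tri_swap] at this
    linarith

lemma seg_not_neg {p q a b x : Pt} (ha : 0 ≤ tri p q a) (hb : 0 ≤ tri p q b)
    (hx : x ∈ segment ℝ a b) : ¬ 0 < tri q p x := by
  have := (convex_nonneg p q).segment_subset ha hb hx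
  simp only [mem_ofPred_eq] at this
  rw [tri_swap]; linarith

/-- The sign conditions for a pseudo-triangle `A a₁ a₂ B b C c`. -/
structure PTSigns (A a₁ a₂ B b C c : Pt) : Prop where
  h1 : 0 < tri a₁ A a₂
  h2 : 0 < tri a₁ A B
  h3 : 0 < tri A a₁ C
  h4 : 0 < tri A a₁ c
  h5 : 0 < tri a₂ a₁ B
  h6 : 0 < tri a₁ a₂ C
  h7 : 0 < tri B a₂ A
  h8 : 0 < tri a₂ B b
  h9 : 0 < tri a₂ B C
  h10 : 0 < tri B b A
  h11 : 0 < tri B b a₁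
  h12 : 0 < tri B b a₂
  h13 : 0 < tri b B C
  h14 : 0 < tri b C A
  h15 : 0 < tri b C c
  h16 : 0 < tri c C A
  h17 : 0 < tri C c B
  h18 : 0 < tri C c b
  h19 : 0 < tri c A a₂
  h20 : 0 < tri c A B
  area : (0 < tri a₁ a₂ b ∧ 0 < tri a₁ b c) ∨ (0 < tri a₂ b c ∧ 0 < tri a₁ a₂ c)

/-- The polygon with the given seven vertices. -/
def poly7 (A a₁ a₂ B b C c : Pt) : ZMod 7 → Pt := ![A, a₁, a₂, B, b, C, c]

section
variable {A a₁ a₂ B b C c : Pt}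

lemma poly7_cases (P : ZMod 7 → Prop) (h0 : P 0) (h1 : P 1) (h2 : P 2) (h3 : P 3) (h4 : P 4)
    (h5 : P 5) (h6 : P 6) : ∀ i, P i := by
  intro i
  have : i = 0 ∨ i = 1 ∨ i = 2 ∨ i = 3 ∨ i = 4 ∨ i = 5 ∨ i = 6 := by
    revert i; decide
  rcases this with rfl | rfl | rfl | rfl | rfl | rfl | rfl <;> assumption

lemma poly7_edge (P : Pt → Pt → Prop) (h0 : P A a₁) (h1 : P a₁ a₂) (h2 : P a₂ B) (h3 : P B b)
    (h4 : P b C) (h5 : P C c) (h6 : P c A) :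
    ∀ i, P (poly7 A a₁ a₂ B b C c i) (poly7 A a₁ a₂ B b C c (i + 1)) :=
  poly7_cases _ h0 h1 h2 h3 h4 h5 h6

lemma poly7_area (h : PTSigns A a₁ a₂ B b C c) : 0 < signedArea 7 (poly7 A a₁ a₂ B b C c) := by
  have e : signedArea 7 (poly7 A a₁ a₂ B b C c) =
      cross2 A a₁ + cross2 a₁ a₂ + cross2 a₂ B + cross2 B b + cross2 b C + cross2 C c
        + cross2 c A := by
    unfold signedArea
    rw [dif_neg (by norm_num)]
    exact Fin.sum_univ_seven _
  rw [e]
  obtain ⟨h1, h2, h3, h4, h5, h6, h7, h8, h9, h10, h11, h12, h13, h14, h15, h16, h17, h18, h19,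
    h20, har⟩ := h
  simp only [tri_def] at h4 h8 h15 har
  simp only [cross2]
  rcases har with ⟨x, y⟩ | ⟨x, y⟩ <;> nlinarith

end

end NinePts
namespace NinePts

section
variable {A a₁ a₂ B b C c : Pt}

lemma poly7_simple (h : PTSigns A a₁ a₂ B b C c) :
    IsSimplePolygon 7 (poly7 A a₁ a₂ B b C c) := by
  obtain ⟨h1, h2, h3, h4, h5, h6, h7, h8, h9, h10, h11, h12, h13, h14, h15, h16, h17, h18, h19,
    h20, -⟩ := h
  have n1 : tri A a₁ a₂ < 0 := by rw [tri_swap] at h1; linarith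
  have n2 : tri A a₁ B < 0 := by rw [tri_swap] at h2; linarith
  have n5 : tri a₁ a₂ B < 0 := by rw [tri_swap] at h5; linarith
  have n7 : tri a₂ B A < 0 := by rw [tri_swap] at h7; linarith
  have n5' : tri a₂ B a₁ < 0 := by rw [tri_rot a₁ a₂ B]; exact n5
  have n13 : tri B b C < 0 := by rw [tri_swap] at h13; linarith
  have n16 : tri C c A < 0 := by rw [tri_swap] at h16; linarith
  have p4 : 0 < tri c A a₁ := by rw [tri_rot' A a₁ c]; exact h4
  have n16' : tri c A C < 0 := by rw [tri_rot C c A]; exact n16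
  have d02 : segment ℝ a₂ B ∩ segment ℝ A a₁ = ∅ := by
    rw [inter_comm]
    refine seg_disj B a₂ _ _ _ _ h7 ?_ ?_ ?_
    · rw [tri_swap]; linarith
    · simp
    · simp
  have d03 : segment ℝ A a₁ ∩ segment ℝ B b = ∅ :=
    seg_disj B b _ _ _ _ h10 h11 (by simp) (by simp)
  have d04 : segment ℝ A a₁ ∩ segment ℝ b C = ∅ :=
    seg_disj B b _ _ _ _ h10 h11 (by simp) n13.le
  have d13 : segment ℝ a₁ a₂ ∩ segment ℝ B b = ∅ :=
    seg_disj B b _ _ _ _ h11 h12 (by simp) (by simp)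
  have d14 : segment ℝ a₁ a₂ ∩ segment ℝ b C = ∅ :=
    seg_disj B b _ _ _ _ h11 h12 (by simp) n13.le
  have d05 : segment ℝ C c ∩ segment ℝ A a₁ = ∅ :=
    seg_disj A a₁ _ _ _ _ h3 h4 (by simp) (by simp)
  have d15 : segment ℝ a₁ a₂ ∩ segment ℝ C c = ∅ :=
    seg_disj c A _ _ _ _ p4 h19 n16'.le (by simp)
  have d25 : segment ℝ a₂ B ∩ segment ℝ C c = ∅ :=
    seg_disj c A _ _ _ _ h19 h20 n16'.le (by simp)
  have d16 : segment ℝ a₁ a₂ ∩ segment ℝ c A = ∅ :=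
    seg_disj c A _ _ _ _ p4 h19 (by simp) (by simp)
  have d26 : segment ℝ a₂ B ∩ segment ℝ c A = ∅ :=
    seg_disj c A _ _ _ _ h19 h20 (by simp) (by simp)
  have d24 : segment ℝ b C ∩ segment ℝ a₂ B = ∅ :=
    seg_disj a₂ B _ _ _ _ h8 h9 (by simp) (by simp)
  have d35 : segment ℝ B b ∩ segment ℝ C c = ∅ :=
    seg_disj C c _ _ _ _ h17 h18 (by simp) (by simp)
  have d36 : segment ℝ B b ∩ segment ℝ c A = ∅ :=
    seg_disj C c _ _ _ _ h17 h18 (by simp) n16.le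
  have d46 : segment ℝ c A ∩ segment ℝ b C = ∅ :=
    seg_disj b C _ _ _ _ h15 h14 (by simp) (by simp)
  refine ⟨by norm_num, ?_, ?_, ?_⟩
  · have k01 : A ≠ a₁ := by rintro rfl; simp at h1
    have k02 : A ≠ a₂ := by rintro rfl; simp at h1
    have k03 : A ≠ B := by rintro rfl; simp at h2
    have k04 : A ≠ b := by rintro rfl; simp at h10
    have k05 : A ≠ C := by rintro rfl; simp at h3
    have k06 : A ≠ c := by rintro rfl; simp at h4
    have k12 : a₁ ≠ a₂ := by rintro rfl; simp at h1
    have k13 : a₁ ≠ B := by rintro rfl; simp at h2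
    have k14 : a₁ ≠ b := by rintro rfl; simp at h11
    have k15 : a₁ ≠ C := by rintro rfl; simp at h3
    have k16 : a₁ ≠ c := by rintro rfl; simp at h4
    have k23 : a₂ ≠ B := by rintro rfl; simp at h5
    have k24 : a₂ ≠ b := by rintro rfl; simp at h8
    have k25 : a₂ ≠ C := by rintro rfl; simp at h6
    have k26 : a₂ ≠ c := by rintro rfl; simp at h19
    have k34 : B ≠ b := by rintro rfl; simp at h8
    have k35 : B ≠ C := by rintro rfl; simp at h9
    have k36 : B ≠ c := by rintro rfl; simp at h17
    have k45 : b ≠ C := by rintro rfl; simp at h13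
    have k46 : b ≠ c := by rintro rfl; simp at h15
    have k56 : C ≠ c := by rintro rfl; simp at h15
    refine poly7_cases _ ?_ ?_ ?_ ?_ ?_ ?_ ?_ <;> refine poly7_cases _ ?_ ?_ ?_ ?_ ?_ ?_ ?_ <;>
      intro h <;> first
        | rfl
        | (exfalso; exact k01 h) | (exfalso; exact k02 h) | (exfalso; exact k03 h)
        | (exfalso; exact k04 h) | (exfalso; exact k05 h) | (exfalso; exact k06 h)
        | (exfalso; exact k12 h) | (exfalso; exact k13 h) | (exfalso; exact k14 h)
        | (exfalso; exact k15 h) | (exfalso; exact k16 h) | (exfalso; exact k23 h)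
        | (exfalso; exact k24 h) | (exfalso; exact k25 h) | (exfalso; exact k26 h)
        | (exfalso; exact k34 h) | (exfalso; exact k35 h) | (exfalso; exact k36 h)
        | (exfalso; exact k45 h) | (exfalso; exact k46 h) | (exfalso; exact k56 h)
        | (exfalso; exact k01 h.symm) | (exfalso; exact k02 h.symm) | (exfalso; exact k03 h.symm)
        | (exfalso; exact k04 h.symm) | (exfalso; exact k05 h.symm) | (exfalso; exact k06 h.symm)
        | (exfalso; exact k12 h.symm) | (exfalso; exact k13 h.symm) | (exfalso; exact k14 h.symm)
        | (exfalso; exact k15 h.symm) | (exfalso; exact k16 h.symm) | (exfalso; exact k23 h.symm)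
        | (exfalso; exact k24 h.symm) | (exfalso; exact k25 h.symm) | (exfalso; exact k26 h.symm)
        | (exfalso; exact k34 h.symm) | (exfalso; exact k35 h.symm) | (exfalso; exact k36 h.symm)
        | (exfalso; exact k45 h.symm) | (exfalso; exact k46 h.symm) | (exfalso; exact k56 h.symm)
  · refine poly7_cases _ ?_ ?_ ?_ ?_ ?_ ?_ ?_ <;> refine poly7_cases _ ?_ ?_ ?_ ?_ ?_ ?_ ?_ <;>
      intro e1 e2 e3 <;> first
        | exact absurd rfl e1 | exact absurd rfl e2 | exact absurd rfl e3
        | exact d02 | exact d03 | exact d04 | exact d13 | exact d14 | exact d05 | exact d15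
        | exact d25 | exact d16 | exact d26 | exact d24 | exact d35 | exact d36 | exact d46
        | (rw [inter_comm]; first
            | exact d02 | exact d03 | exact d04 | exact d13 | exact d14 | exact d05 | exact d15
            | exact d25 | exact d16 | exact d26 | exact d24 | exact d35 | exact d36 | exact d46)
  · refine poly7_cases _ ?_ ?_ ?_ ?_ ?_ ?_ ?_
    · exact seg_adj A a₁ a₂ n1.ne
    · exact seg_adj a₁ a₂ B n5.ne
    · exact seg_adj a₂ B b h8.ne'
    · exact seg_adj B b C n13.ne
    · exact seg_adj b C c h15.ne'
    · exact seg_adj C c A n16.ne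
    · exact seg_adj c A a₁ p4.ne'

lemma poly7_pt (h : PTSigns A a₁ a₂ B b C c) :
    IsPseudoTriangle 7 (poly7 A a₁ a₂ B b C c) := by
  have har := poly7_area h
  have hs := poly7_simple h
  obtain ⟨h1, h2, h3, h4, h5, h6, h7, h8, h9, h10, h11, h12, h13, h14, h15, h16, h17, h18, h19,
    h20, -⟩ := h
  have key : ∀ x y z : Pt, cross2 (y - x) (z - y) = tri x y z := by
    intro x y z
    simp only [tri_def, cross2, Prod.fst_sub, Prod.snd_sub]; ring
  set v := poly7 A a₁ a₂ B b C c with hv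
  have v0 : 0 < vtxCross 7 v 0 := by
    have : vtxCross 7 v 0 = tri c A a₁ := key _ _ _
    rw [this, tri_rot' A a₁ c]; exact h4
  have v1 : vtxCross 7 v 1 < 0 := by
    have : vtxCross 7 v 1 = tri A a₁ a₂ := key _ _ _
    rw [this, tri_swap a₁ A]; linarith
  have v2 : vtxCross 7 v 2 < 0 := by
    have : vtxCross 7 v 2 = tri a₁ a₂ B := key _ _ _
    rw [this, tri_swap a₂ a₁]; linarith
  have v3 : 0 < vtxCross 7 v 3 := by
    have : vtxCross 7 v 3 = tri a₂ B b := key _ _ _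
    rw [this]; exact h8
  have v4 : vtxCross 7 v 4 < 0 := by
    have : vtxCross 7 v 4 = tri B b C := key _ _ _
    rw [this, tri_swap b B]; linarith
  have v5 : 0 < vtxCross 7 v 5 := by
    have : vtxCross 7 v 5 = tri b C c := key _ _ _
    rw [this]; exact h15
  have v6 : vtxCross 7 v 6 < 0 := by
    have : vtxCross 7 v 6 = tri C c A := key _ _ _
    rw [this, tri_swap c C]; linarith
  refine ⟨hs, poly7_cases _ v0.ne' v1.ne v2.ne v3.ne' v4.ne v5.ne' v6.ne, ?_⟩
  have hset : {i : ZMod 7 | IsConvexVtx 7 v i} = (({0, 3, 5} : Finset (ZMod 7)) : Set (ZMod 7)) := by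
    ext i
    revert i
    simp only [mem_ofPred_eq, IsConvexVtx, mul_pos_iff_of_pos_right har, Finset.mem_coe]
    refine poly7_cases _ ?_ ?_ ?_ ?_ ?_ ?_ ?_
    · exact iff_of_true v0 (by decide)
    · exact iff_of_false v1.le.not_gt (by decide)
    · exact iff_of_false v2.le.not_gt (by decide)
    · exact iff_of_true v3 (by decide)
    · exact iff_of_false v4.le.not_gt (by decide)
    · exact iff_of_true v5 (by decide)
    · exact iff_of_false v6.le.not_gt (by decide)
  rw [hset, Set.ncard_coe_finset]
  decide

lemma out_AB (h : PTSigns A a₁ a₂ B b C c) {q : Pt} (q1 : 0 < tri a₁ A q) (q2 : 0 < tri a₂ a₁ q)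
    (q3 : 0 < tri B a₂ q) : q ∉ polyInterior 7 (poly7 A a₁ a₂ B b C c) := by
  obtain ⟨h1, h2, h3, h4, h5, h6, h7, h8, h9, h10, h11, h12, h13, h14, h15, h16, h17, h18, h19,
    h20, -⟩ := h
  refine not_interior ({x | 0 < tri a₁ A x} ∩ {x | 0 < tri a₂ a₁ x} ∩ {x | 0 < tri B a₂ x})
    (((convex_pos _ _).inter (convex_pos _ _)).inter (convex_pos _ _)) ⟨⟨q1, q2⟩, q3⟩ (A - C)
    ?_ ?_ ?_
  · intro e
    rw [sub_eq_zero] at e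
    subst e; simp at h3
  · intro t ht
    refine ⟨⟨?_, ?_⟩, ?_⟩ <;> simp only [mem_ofPred_eq, tri_add_smul]
    · have e : tri a₁ A C = - tri A a₁ C := tri_swap _ _ _
      rw [e, tri_right]; nlinarith
    · have e : tri a₂ a₁ C = - tri a₁ a₂ C := tri_swap _ _ _
      have e2 : tri a₂ a₁ A = tri a₁ A a₂ := tri_rot' _ _ _
      rw [e, e2]; nlinarith
    · have e : tri B a₂ C = - tri a₂ B C := tri_swap _ _ _
      rw [e]; nlinarith
  · have p4 : 0 < tri A a₁ c := h4
    refine poly7_edge (fun u w => ∀ x ∈ segment ℝ u w, x ∉ _) ?_ ?_ ?_ ?_ ?_ ?_ ?_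
    · rintro x hx ⟨⟨k1, k2⟩, k3⟩
      exact seg_not_neg (by simp) (by simp) hx k1
    · rintro x hx ⟨⟨k1, k2⟩, k3⟩
      exact seg_not_neg (by simp) (by simp) hx k2
    · rintro x hx ⟨⟨k1, k2⟩, k3⟩
      exact seg_not_neg (by simp) (by simp) hx k3
    · rintro x hx ⟨⟨k1, k2⟩, k3⟩
      exact seg_not_neg (by simp) h8.le hx k3
    · rintro x hx ⟨⟨k1, k2⟩, k3⟩
      exact seg_not_neg h8.le h9.le hx k3
    · rintro x hx ⟨⟨k1, k2⟩, k3⟩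
      exact seg_not_neg h3.le h4.le hx k1
    · rintro x hx ⟨⟨k1, k2⟩, k3⟩
      exact seg_not_neg h4.le (by simp) hx k1

lemma out_BC (h : PTSigns A a₁ a₂ B b C c) {q : Pt} (q1 : 0 < tri b B q) (q2 : 0 < tri C b q) :
    q ∉ polyInterior 7 (poly7 A a₁ a₂ B b C c) := by
  obtain ⟨h1, h2, h3, h4, h5, h6, h7, h8, h9, h10, h11, h12, h13, h14, h15, h16, h17, h18, h19,
    h20, -⟩ := h
  refine not_interior ({x | 0 < tri b B x} ∩ {x | 0 < tri C b x})
    ((convex_pos _ _).inter (convex_pos _ _)) ⟨q1, q2⟩ (B - A) ?_ ?_ ?_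
  · intro e
    rw [sub_eq_zero] at e
    subst e; simp at h10
  · intro t ht
    refine ⟨?_, ?_⟩ <;> simp only [mem_ofPred_eq, tri_add_smul]
    · have e : tri b B A = - tri B b A := tri_swap _ _ _
      rw [e, tri_right]; nlinarith
    · have e : tri C b A = - tri b C A := tri_swap _ _ _
      have e2 : tri C b B = tri b B C := tri_rot' _ _ _
      rw [e, e2]; nlinarith
  · refine poly7_edge (fun u w => ∀ x ∈ segment ℝ u w, x ∉ _) ?_ ?_ ?_ ?_ ?_ ?_ ?_
    · rintro x hx ⟨k1, k2⟩
      exact seg_not_neg h10.le h11.le hx k1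
    · rintro x hx ⟨k1, k2⟩
      exact seg_not_neg h11.le h12.le hx k1
    · rintro x hx ⟨k1, k2⟩
      exact seg_not_neg h12.le (by simp) hx k1
    · rintro x hx ⟨k1, k2⟩
      exact seg_not_neg (by simp) (by simp) hx k1
    · rintro x hx ⟨k1, k2⟩
      exact seg_not_neg (by simp) (by simp) hx k2
    · rintro x hx ⟨k1, k2⟩
      exact seg_not_neg (by simp) h15.le hx k2
    · rintro x hx ⟨k1, k2⟩
      exact seg_not_neg h15.le h14.le hx k2

lemma out_CA (h : PTSigns A a₁ a₂ B b C c) {q : Pt} (q1 : 0 < tri c C q) (q2 : 0 < tri A c q) :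
    q ∉ polyInterior 7 (poly7 A a₁ a₂ B b C c) := by
  obtain ⟨h1, h2, h3, h4, h5, h6, h7, h8, h9, h10, h11, h12, h13, h14, h15, h16, h17, h18, h19,
    h20, -⟩ := h
  refine not_interior ({x | 0 < tri c C x} ∩ {x | 0 < tri A c x})
    ((convex_pos _ _).inter (convex_pos _ _)) ⟨q1, q2⟩ (C - B) ?_ ?_ ?_
  · intro e
    rw [sub_eq_zero] at e
    subst e; simp at h13
  · intro t ht
    refine ⟨?_, ?_⟩ <;> simp only [mem_ofPred_eq, tri_add_smul]
    · have e : tri c C B = - tri C c B := tri_swap _ _ _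
      rw [e, tri_right]; nlinarith
    · have e : tri A c B = - tri c A B := tri_swap _ _ _
      have e2 : tri A c C = tri c C A := tri_rot' _ _ _
      rw [e, e2]; nlinarith
  · have p4 : 0 < tri c A a₁ := by rw [tri_rot' A a₁ c]; exact h4
    refine poly7_edge (fun u w => ∀ x ∈ segment ℝ u w, x ∉ _) ?_ ?_ ?_ ?_ ?_ ?_ ?_
    · rintro x hx ⟨k1, k2⟩
      exact seg_not_neg (by simp) p4.le hx k2
    · rintro x hx ⟨k1, k2⟩
      exact seg_not_neg p4.le h19.le hx k2
    · rintro x hx ⟨k1, k2⟩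
      exact seg_not_neg h19.le h20.le hx k2
    · rintro x hx ⟨k1, k2⟩
      exact seg_not_neg h17.le h18.le hx k1
    · rintro x hx ⟨k1, k2⟩
      exact seg_not_neg h18.le (by simp) hx k1
    · rintro x hx ⟨k1, k2⟩
      exact seg_not_neg (by simp) (by simp) hx k1
    · rintro x hx ⟨k1, k2⟩
      exact seg_not_neg (by simp) (by simp) hx k2

lemma vertex_not_interior (v : ZMod 7 → Pt) (i : ZMod 7) : v i ∉ polyInterior 7 v := by
  rintro ⟨h, -⟩
  exact h (mem_iUnion.mpr ⟨i, left_mem_segment ℝ _ _⟩)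

end

end NinePts
namespace NinePts

/-- Bit number of the fact that the triple `(i, j, k)` is positively oriented. -/
def pbit (i j k : ℕ) : ℕ := 9 * (9 * i + j) + k

/-- Bit number of the fact that the triangle `i < j < k` is empty. -/
def ebit (i j k : ℕ) : ℕ := 729 + pbit i j k

/-- Offset of the field of points to the left of the line `i j`. -/
def fld (i j : ℕ) : ℕ := 9 * (9 * i + j)

/-- The bit mask of a list of bit numbers. -/
def mk (l : List ℕ) : ℕ := l.foldr (fun v m => Nat.lor (Nat.shiftLeft 1 v) m) 0

/-- `between i k` lists the numbers strictly between `i` and `k`. -/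
def between (i k : ℕ) : List ℕ := List.range' (i + 1) (k - 1 - i)

/-- The three bits stating that `(i, j, k)` is positively oriented. -/
def facts (i j k : ℕ) : ℕ := mk [pbit i j k, pbit j k i, pbit k i j]

/-- A step of the search transforms the rest of the search (a test on states). -/
abbrev Step := (ℕ → Bool) → ℕ → Bool

/-- Does the state `s` contain all the bits of `m`? -/
def has (s m : ℕ) : Bool := Nat.beq (Nat.land s m) m

/-- If `a` then `true` else `b`. -/
def bor (a b : Bool) : Bool := Bool.rec (motive := fun _ => Bool) b true a

/-- If `a` then `b` else `c`. -/
def ite3 (a b c : Bool) : Bool := Bool.rec (motive := fun _ => Bool) c b a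

/-- Do two fields have a common member in `q`? -/
def both (s o₁ o₂ q : ℕ) : Bool :=
  Nat.ble 1 (Nat.land (Nat.land (Nat.shiftRight s o₁) q) (Nat.shiftRight s o₂))

/-- Do three fields cover `q`? -/
def cov (s o₁ o₂ o₃ q : ℕ) : Bool :=
  Nat.beq (Nat.lor (Nat.lor (Nat.land (Nat.shiftRight s o₁) q) (Nat.land (Nat.shiftRight s o₂) q))
    (Nat.land (Nat.shiftRight s o₃) q)) q

/-- Are all points of `q` outside the pseudo-triangle with the given edge fields? -/
def ptc (s o₁ o₂ o₃ o₄ o₅ o₆ o₇ q : ℕ) : Bool :=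
  has (Nat.lor (Nat.lor
    (Nat.land (Nat.land (Nat.shiftRight s o₁) (Nat.shiftRight s o₂)) (Nat.shiftRight s o₃))
    (Nat.land (Nat.shiftRight s o₄) (Nat.shiftRight s o₅)))
    (Nat.land (Nat.shiftRight s o₆) (Nat.shiftRight s o₇))) q

/-- One side of a branching. -/
def doSide (n₁ n₂ n₃ n₄ q₁ q₂ neg : ℕ) (f : ℕ → Bool) (s : ℕ) : Bool :=
  bor (both s n₁ n₂ q₁) (bor (both s n₃ n₄ q₂) (f (Nat.lor s neg)))

/-- Branching. -/
def doBr (n₁ n₂ n₃ n₄ p₁ p₂ p₃ p₄ q₁ q₂ neg pos : ℕ) (f : ℕ → Bool) (s : ℕ) : Bool :=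
  ite3 (doSide n₁ n₂ n₃ n₄ q₁ q₂ neg f s) (doSide p₁ p₂ p₃ p₄ q₁ q₂ pos f s) false

/-- Closing a case. -/
def doKill (m : ℕ) (f : ℕ → Bool) (s : ℕ) : Bool := bor (has s m) (f s)

/-- Recording emptiness of a triangle. -/
def doEmp (e m₁ a₁ b₁ c₁ m₂ a₂ b₂ c₂ q : ℕ) (f : ℕ → Bool) (s : ℕ) : Bool :=
  ite3 (ite3 (has s m₁) (cov s a₁ b₁ c₁ q) (ite3 (has s m₂) (cov s a₂ b₂ c₂ q) false))
    (f (Nat.lor s e)) (f s)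

/-- Closing a case with a pseudo-triangle. -/
def doPt (m m₁ m₂ o₁ o₂ o₃ o₄ o₅ o₆ o₇ q : ℕ) (f : ℕ → Bool) (s : ℕ) : Bool :=
  bor (ite3 (has s m) (ite3 (bor (has s m₁) (has s m₂)) (ptc s o₁ o₂ o₃ o₄ o₅ o₆ o₇ q) false)
    false) (f s)

/-- Run the search. -/
def run (l : List Step) : ℕ → Bool :=
  List.rec (motive := fun _ => ℕ → Bool) (fun _ => false) (fun st _ f => st f) l

/-- Decide the orientation of `i < j < k`. -/
def brStep (i j k : ℕ) : Step :=
  doBr (fld k i) (fld j k) (fld i j) (fld k j) (fld i k) (fld k j) (fld j i) (fld j k)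
    (mk (between i j)) (mk (between j k)) (facts j i k) (facts i j k)

/-- Record emptiness of the triangle `x y z`. -/
def empStep (x y z : ℕ) (l : List ℕ) : Step :=
  doEmp (mk [ebit x y z]) (mk [pbit x y z]) (fld y x) (fld z y) (fld x z)
    (mk [pbit y x z]) (fld x y) (fld y z) (fld z x) (mk l)

/-- All triangles spanned by the index list `l` are empty. -/
def holeStep (l : List ℕ) : Step :=
  doKill (mk (l.flatMap fun i => l.flatMap fun j => l.flatMap fun k =>
    if i < j ∧ j < k then [ebit i j k] else []))

/-- Sign conditions for a pseudo-triangle `A a₁ a₂ B b C c` with corners `A`, `B`, `C`. -/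
def ptCore (A a₁ a₂ B b C c : ℕ) : List ℕ :=
  [pbit a₁ A a₂, pbit a₁ A B, pbit A a₁ C, pbit A a₁ c,
    pbit a₂ a₁ B, pbit a₁ a₂ C,
    pbit B a₂ A, pbit a₂ B b, pbit a₂ B C,
    pbit B b A, pbit B b a₁, pbit B b a₂, pbit b B C,
    pbit b C A, pbit b C c,
    pbit c C A, pbit C c B, pbit C c b,
    pbit c A a₂, pbit c A B]

/-- Kill step for the candidate pseudo-triangle `t` in the island `{0, i, ..., k}`. -/
def ptStep (i k : ℕ) (t : List ℕ) : List Step :=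
  match t with
  | [A, a₁, a₂, B, b, C, c] =>
    if t.Nodup ∧ (∀ x ∈ t, x = 0 ∨ (i ≤ x ∧ x ≤ k)) ∧ i ∈ t ∧ k ∈ t then
      [doPt (mk (ptCore A a₁ a₂ B b C c))
        (mk [pbit a₁ a₂ b, pbit a₁ b c]) (mk [pbit a₂ b c, pbit a₁ a₂ c])
        (fld a₁ A) (fld a₂ a₁) (fld B a₂) (fld b B) (fld C b) (fld c C) (fld A c)
        (mk ((0 :: between i k).filter (· ∉ t)))]
    else []
  | _ => []

/-- Candidate pseudo-triangles, written as decimal digit strings `A a₁ a₂ B b C c`. -/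
def cands : List ℕ :=
  [7650324, 0432576, 0431576, 8760435, 8640325, 8650324, 0321475, 0321574, 7650314, 7650413,
   0421375, 8750436, 7650423, 0542687, 0642587, 0652487, 0431586, 0431587, 0531486, 0532476,
   0541386, 0321674, 0432586, 0432685, 2567403, 0321465, 6540213, 0321564, 0532486, 0643587,
   0543687, 1357402, 1567403, 0541276, 0542386, 0652387, 0653487, 1457302, 0421365, 1456302,
   0321476, 0321576, 0421376, 0421576, 0431265, 0521376, 0521476, 1234675, 1235674, 1243675,
   1245673, 1253674, 1254673, 0431275, 0431675, 0432675]

/-- Decimal digits. -/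
def digits7 (n : ℕ) : List ℕ :=
  [n / 1000000 % 10, n / 100000 % 10, n / 10000 % 10, n / 1000 % 10, n / 100 % 10, n / 10 % 10, n % 10]

/-- Block of steps completing the island `{0, i, ..., k}`. -/
def block (i k : ℕ) : List Step :=
  ((between i k).map fun j => brStep i j k) ++
  ((between i k).map fun b => empStep i b k ((between i k).filter (· ≠ b))) ++
  [empStep 0 i k (between i k)] ++
  ((between i k).flatMap fun b => (between b k).flatMap fun c =>
    holeStep [0, i, b, c, k] :: (between c k).map fun d => holeStep [i, b, c, d, k]) ++
  (cands.flatMap fun n => ptStep i k (digits7 n))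

/-- The whole search. -/
def steps : List Step :=
  (List.range 9).flatMap fun k => (List.range k).reverse.flatMap fun i =>
    if 1 ≤ i then block i k else []

/-- The initial state: facts about the extreme point `0`. -/
def start0 : ℕ :=
  mk ((List.range 9).flatMap fun k => (between 0 k).flatMap fun j =>
    [pbit 0 j k, pbit j k 0, pbit k 0 j])


end NinePts

namespace NinePts

/-- A sorted configuration of nine points of `S` around the extreme point `p 0`. -/
structure Cfg (S : Set Pt) (p : ℕ → Pt) : Prop where
  mem : ∀ i, i < 9 → p i ∈ S
  inj : ∀ i j, i < 9 → j < 9 → p i = p j → i = j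
  root : ∀ i j, 0 < i → i < j → j < 9 → 0 < tri (p 0) (p i) (p j)
  gen : ∀ i j k, i < 9 → j < 9 → k < 9 → i ≠ j → i ≠ k → j ≠ k → tri (p i) (p j) (p k) ≠ 0
  far : ∀ q ∈ S, (∃ m, m < 9 ∧ q = p m) ∨ ∀ k, 0 < k → k < 9 → 0 < tri (p 0) (p k) q

/-- The triangle `a b c` contains no further point of `S`. -/
def Emp (S : Set Pt) (a b c : Pt) : Prop :=
  ∀ q ∈ S, q ∈ convexHull ℝ ({a, b, c} : Set Pt) → q ∈ ({a, b, c} : Set Pt)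

/-- Meaning of a bit. -/
def Mng (S : Set Pt) (p : ℕ → Pt) (v : ℕ) : Prop :=
  if v < 729 then 0 < tri (p (v / 81)) (p (v / 9 % 9)) (p (v % 9))
  else Emp S (p ((v - 729) / 81)) (p ((v - 729) / 9 % 9)) (p ((v - 729) % 9))

/-- All bits of `s` are valid. -/
def Inv (S : Set Pt) (p : ℕ → Pt) (s : ℕ) : Prop := ∀ v, s.testBit v = true → Mng S p v

/-- The goal. -/
def Goal (S : Set Pt) : Prop := HasHole 5 S ∨ HasEmptyPseudoTriangle 7 S

/-- Soundness of a step. -/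
def Sound (S : Set Pt) (p : ℕ → Pt) (g : Step) : Prop :=
  ∀ f s, Inv S p s → g f s = true → Goal S ∨ ∃ s', Inv S p s' ∧ f s' = true

variable {S : Set Pt} {p : ℕ → Pt}

lemma run_sound (l : List Step) (hl : ∀ g ∈ l, Sound S p g) :
    ∀ s, Inv S p s → run l s = true → Goal S := by
  induction l with
  | nil => intro s _ h; exact absurd h (by simp [run])
  | cons g l ih =>
    intro s hs h
    have h' : g (run l) s = true := h
    rcases hl g (by simp) _ _ hs h' with h | ⟨s', h1, h2⟩
    · exact h
    · exact ih (fun g hg => hl g (by simp [hg])) s' h1 h2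

lemma mng_pbit {i j k : ℕ} (hi : i < 9) (hj : j < 9) (hk : k < 9) :
    Mng S p (pbit i j k) ↔ 0 < tri (p i) (p j) (p k) := by
  unfold Mng
  have h0 : pbit i j k < 729 := by unfold pbit; omega
  have h1 : pbit i j k / 81 = i := by unfold pbit; omega
  have h2 : pbit i j k / 9 % 9 = j := by unfold pbit; omega
  have h3 : pbit i j k % 9 = k := by unfold pbit; omega
  rw [if_pos h0, h1, h2, h3]

lemma mng_ebit {i j k : ℕ} (hi : i < 9) (hj : j < 9) (hk : k < 9) :
    Mng S p (ebit i j k) ↔ Emp S (p i) (p j) (p k) := by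
  unfold Mng
  have h0 : ¬ ebit i j k < 729 := by unfold ebit; omega
  have h1 : (ebit i j k - 729) / 81 = i := by unfold ebit pbit; omega
  have h2 : (ebit i j k - 729) / 9 % 9 = j := by unfold ebit pbit; omega
  have h3 : (ebit i j k - 729) % 9 = k := by unfold ebit pbit; omega
  rw [if_neg h0, h1, h2, h3]

lemma testBit_mk (l : List ℕ) (v : ℕ) : (mk l).testBit v = true ↔ v ∈ l := by
  induction l with
  | nil => simp [mk]
  | cons a l ih =>
    have e : mk (a :: l) = (1 <<< a) ||| mk l := rfl
    rw [e, Nat.testBit_or, Bool.or_eq_true, ih, List.mem_cons, Nat.one_shiftLeft,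
      Nat.testBit_two_pow]
    simp [eq_comm]

lemma inv_mk (l : List ℕ) : Inv S p (mk l) ↔ ∀ v ∈ l, Mng S p v := by
  simp only [Inv, testBit_mk]

lemma inv_lor {s t : ℕ} (hs : Inv S p s) (ht : Inv S p t) : Inv S p (Nat.lor s t) := by
  intro v hv
  have e : Nat.lor s t = s ||| t := rfl
  rw [e, Nat.testBit_or, Bool.or_eq_true] at hv
  exact hv.elim (hs v) (ht v)

lemma has_testBit {s m : ℕ} (h : has s m = true) {v : ℕ} (hv : m.testBit v = true) :
    s.testBit v = true := by
  have e : s &&& m = m := Nat.eq_of_beq_eq_true h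
  rw [← e, Nat.testBit_and, Bool.and_eq_true] at hv
  exact hv.1

lemma inv_has {s : ℕ} {l : List ℕ} (hs : Inv S p s) (h : has s (mk l) = true) :
    ∀ v ∈ l, Mng S p v := fun v hv => hs v (has_testBit h ((testBit_mk l v).mpr hv))

lemma fld_bit {s i j b : ℕ} (hs : Inv S p s) (h : (Nat.shiftRight s (fld i j)).testBit b = true)
    (hi : i < 9) (hj : j < 9) (hb : b < 9) : 0 < tri (p i) (p j) (p b) := by
  have e : Nat.shiftRight s (fld i j) = s >>> fld i j := rfl
  rw [e, Nat.testBit_shiftRight] at h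
  exact (mng_pbit hi hj hb).mp (hs _ h)

lemma both_bit {s o₁ o₂ q : ℕ} (h : both s o₁ o₂ q = true) :
    ∃ b, q.testBit b = true ∧ (Nat.shiftRight s o₁).testBit b = true ∧
      (Nat.shiftRight s o₂).testBit b = true := by
  have h1 := Nat.le_of_ble_eq_true h
  obtain ⟨b, hb⟩ := Nat.exists_testBit_of_ne_zero (by omega :
    Nat.land (Nat.land (Nat.shiftRight s o₁) q) (Nat.shiftRight s o₂) ≠ 0)
  have e : ∀ x y : ℕ, Nat.land x y = x &&& y := fun _ _ => rfl
  rw [e, e, Nat.testBit_and, Nat.testBit_and, Bool.and_eq_true, Bool.and_eq_true] at hb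
  exact ⟨b, hb.1.2, hb.1.1, hb.2⟩

lemma cov_bit {s o₁ o₂ o₃ q b : ℕ} (h : cov s o₁ o₂ o₃ q = true) (hb : q.testBit b = true) :
    (Nat.shiftRight s o₁).testBit b = true ∨ (Nat.shiftRight s o₂).testBit b = true ∨
      (Nat.shiftRight s o₃).testBit b = true := by
  have h1 := Nat.eq_of_beq_eq_true h
  have e : ∀ x y : ℕ, Nat.land x y = x &&& y := fun _ _ => rfl
  have e' : ∀ x y : ℕ, Nat.lor x y = x ||| y := fun _ _ => rfl
  rw [← h1] at hb
  simp only [e, e', Nat.testBit_and, Nat.testBit_or, Bool.and_eq_true, Bool.or_eq_true] at hb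
  tauto

lemma ptc_bit {s o₁ o₂ o₃ o₄ o₅ o₆ o₇ q b : ℕ} (h : ptc s o₁ o₂ o₃ o₄ o₅ o₆ o₇ q = true)
    (hb : q.testBit b = true) :
    ((Nat.shiftRight s o₁).testBit b = true ∧ (Nat.shiftRight s o₂).testBit b = true ∧
      (Nat.shiftRight s o₃).testBit b = true) ∨
    ((Nat.shiftRight s o₄).testBit b = true ∧ (Nat.shiftRight s o₅).testBit b = true) ∨
    ((Nat.shiftRight s o₆).testBit b = true ∧ (Nat.shiftRight s o₇).testBit b = true) := by
  have h1 := has_testBit h hb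
  have e : ∀ x y : ℕ, Nat.land x y = x &&& y := fun _ _ => rfl
  have e' : ∀ x y : ℕ, Nat.lor x y = x ||| y := fun _ _ => rfl
  simp only [e, e', Nat.testBit_and, Nat.testBit_or, Bool.and_eq_true, Bool.or_eq_true] at h1
  tauto

lemma bor_true {a b : Bool} (h : bor a b = true) : a = true ∨ b = true := by
  cases a <;> simp_all [bor]

lemma ite3_true {a b c : Bool} (h : ite3 a b c = true) :
    (a = true ∧ b = true) ∨ (a = false ∧ c = true) := by
  cases a <;> simp_all [ite3]

lemma ite3_and {a b : Bool} (h : ite3 a b false = true) : a = true ∧ b = true := by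
  cases a <;> simp_all [ite3]

lemma mem_between {i k x : ℕ} : x ∈ between i k ↔ i < x ∧ x < k := by
  simp only [between, List.mem_range'_1]; omega

lemma inv_facts {i j k : ℕ} (hi : i < 9) (hj : j < 9) (hk : k < 9)
    (h : 0 < tri (p i) (p j) (p k)) : Inv S p (facts i j k) := by
  unfold facts
  rw [inv_mk]
  intro v hv
  simp only [List.mem_cons, List.not_mem_nil, or_false] at hv
  rcases hv with rfl | rfl | rfl
  · rwa [mng_pbit hi hj hk]
  · rwa [mng_pbit hj hk hi, tri_rot]
  · rwa [mng_pbit hk hi hj, tri_rot']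

lemma gp1 (o a b c d : Pt) :
    tri o a d * tri b c d + tri o c d * tri a b d = tri o b d * tri a c d := by
  simp only [tri_def]; ring

lemma gp2 (o a b c d : Pt) :
    tri o a b * tri b c d + tri o b d * tri a b c = tri o b c * tri a b d := by
  simp only [tri_def]; ring

lemma brStep_sound (hc : Cfg S p) {i j k : ℕ} (hi : 0 < i) (hij : i < j) (hjk : j < k)
    (hk : k < 9) : Sound S p (brStep i j k) := by
  intro f s hs h
  right
  unfold brStep doBr at h
  obtain ⟨hn, hp⟩ := ite3_and h
  have hr := hc.root
  rcases lt_or_gt_of_ne (hc.gen i j k (by omega) (by omega) hk (by omega) (by omega) (by omega))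
    with h0 | h0
  · refine ⟨_, inv_lor hs (inv_facts (i := j) (j := i) (k := k) (by omega) (by omega) hk ?_), ?_⟩
    · rw [tri_swap]; linarith
    · unfold doSide at hn
      rcases bor_true hn with hn | hn
      · exfalso
        obtain ⟨x, hx, h1, h2⟩ := both_bit hn
        rw [testBit_mk, mem_between] at hx
        have h1 := fld_bit hs h1 (by omega) (by omega) (by omega)
        have h2 := fld_bit hs h2 (by omega) (by omega) (by omega)
        rw [tri_rot' (p i) (p x)] at h1
        rw [tri_rot (p x) (p j)] at h2
        have g := gp1 (p 0) (p i) (p x) (p j) (p k)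
        have r1 := hr i k hi (by omega) hk
        have r2 := hr j k (by omega) (by omega) hk
        have r3 := hr x k (by omega) (by omega) hk
        nlinarith [mul_pos r1 h2, mul_pos r2 h1, mul_neg_of_pos_of_neg r3 h0]
      rcases bor_true hn with hn | hn
      · exfalso
        obtain ⟨x, hx, h1, h2⟩ := both_bit hn
        rw [testBit_mk, mem_between] at hx
        have h1 := fld_bit hs h1 (by omega) (by omega) (by omega)
        have h2 := fld_bit hs h2 (by omega) (by omega) (by omega)
        rw [tri_rot' (p j) (p x)] at h2
        have g := gp2 (p 0) (p i) (p j) (p x) (p k)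
        have r1 := hr i j hi (by omega) (by omega)
        have r2 := hr j k (by omega) (by omega) hk
        have r3 := hr j x (by omega) (by omega) (by omega)
        nlinarith [mul_pos r1 h2, mul_pos r2 h1, mul_neg_of_pos_of_neg r3 h0]
      · exact hn
  · refine ⟨_, inv_lor hs (inv_facts (i := i) (j := j) (k := k) (by omega) (by omega) hk h0), ?_⟩
    unfold doSide at hp
    rcases bor_true hp with hn | hn
    · exfalso
      obtain ⟨x, hx, h1, h2⟩ := both_bit hn
      rw [testBit_mk, mem_between] at hx
      have h1 := fld_bit hs h1 (by omega) (by omega) (by omega)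
      have h2 := fld_bit hs h2 (by omega) (by omega) (by omega)
      rw [tri_swap' (p i) (p x)] at h1
      rw [tri_swap'' (p x) (p j)] at h2
      have g := gp1 (p 0) (p i) (p x) (p j) (p k)
      have r1 := hr i k hi (by omega) hk
      have r2 := hr j k (by omega) (by omega) hk
      have r3 := hr x k (by omega) (by omega) hk
      nlinarith [mul_pos r1 h2, mul_pos r2 h1, mul_pos r3 h0]
    rcases bor_true hn with hn | hn
    · exfalso
      obtain ⟨x, hx, h1, h2⟩ := both_bit hn
      rw [testBit_mk, mem_between] at hx
      have h1 := fld_bit hs h1 (by omega) (by omega) (by omega)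
      have h2 := fld_bit hs h2 (by omega) (by omega) (by omega)
      rw [tri_swap (p i) (p j)] at h1
      rw [tri_swap' (p j) (p x)] at h2
      have g := gp2 (p 0) (p i) (p j) (p x) (p k)
      have r1 := hr i j hi (by omega) (by omega)
      have r2 := hr j k (by omega) (by omega) hk
      have r3 := hr j x (by omega) (by omega) (by omega)
      nlinarith [mul_pos r1 h2, mul_pos r2 h1, mul_pos r3 h0]
    · exact hn

lemma hull_nonneg {a b x y z q : Pt} (hx : 0 ≤ tri a b x) (hy : 0 ≤ tri a b y)
    (hz : 0 ≤ tri a b z) (hq : q ∈ convexHull ℝ ({x, y, z} : Set Pt)) : ¬ 0 < tri b a q := by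
  have h : 0 ≤ tri a b q := by
    refine convexHull_min (t := {x | 0 ≤ tri a b x}) ?_ (convex_nonneg a b) hq
    rintro u (rfl | rfl | rfl) <;> assumption
  rw [tri_swap]; linarith

lemma hull_pos {a b x y z q : Pt} (hx : 0 < tri a b x) (hy : 0 < tri a b y)
    (hz : 0 < tri a b z) (hq : q ∈ convexHull ℝ ({x, y, z} : Set Pt)) : 0 < tri a b q := by
  refine convexHull_min (t := {x | 0 < tri a b x}) ?_ (convex_pos a b) hq
  rintro u (rfl | rfl | rfl) <;> assumption

lemma tri_hull_false {x y z q : Pt} (h : 0 < tri x y z)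
    (hq : q ∈ convexHull ℝ ({x, y, z} : Set Pt))
    (ho : 0 < tri y x q ∨ 0 < tri z y q ∨ 0 < tri x z q) : False := by
  rcases ho with ho | ho | ho
  · exact hull_nonneg (by simp) (by simp) h.le hq ho
  · exact hull_nonneg (by rw [tri_rot]; exact h.le) (by simp) (by simp) hq ho
  · exact hull_nonneg (by simp) (by rw [tri_rot']; exact h.le) (by simp) hq ho

lemma empStep_sound_aux {x y z : ℕ} (hx : x < 9) (hy : y < 9) (hz : z < 9) (l : List ℕ)
    (hl : ∀ m ∈ l, m < 9)
    (hS : ∀ q ∈ S, q ∈ convexHull ℝ ({p x, p y, p z} : Set Pt) →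
      q ∈ ({p x, p y, p z} : Set Pt) ∨ ∃ m ∈ l, q = p m) :
    Sound S p (empStep x y z l) := by
  intro f s hs h
  right
  unfold empStep doEmp at h
  rcases ite3_true h with ⟨h1, h2⟩ | ⟨-, h2⟩
  swap
  · exact ⟨s, hs, h2⟩
  refine ⟨_, inv_lor hs ?_, h2⟩
  rw [inv_mk]
  intro v hv
  rw [List.mem_singleton] at hv
  subst hv
  rw [mng_ebit hx hy hz]
  intro q hqS hq
  rcases hS q hqS hq with h3 | ⟨m, hm, rfl⟩
  · exact h3
  exfalso
  have hm9 := hl m hm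
  have hmb := (testBit_mk l m).mpr hm
  rcases ite3_true h1 with ⟨k1, k2⟩ | ⟨-, k⟩
  · have k1 := (mng_pbit hx hy hz).mp (inv_has hs k1 _ (List.mem_singleton_self _))
    refine tri_hull_false k1 hq ?_
    rcases cov_bit k2 hmb with t | t | t
    · exact Or.inl (fld_bit hs t (by omega) (by omega) hm9)
    · exact Or.inr (Or.inl (fld_bit hs t (by omega) (by omega) hm9))
    · exact Or.inr (Or.inr (fld_bit hs t (by omega) (by omega) hm9))
  · obtain ⟨k1, k2⟩ := ite3_and k
    have k1 := (mng_pbit hy hx hz).mp (inv_has hs k1 _ (List.mem_singleton_self _))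
    rw [Set.insert_comm] at hq
    refine tri_hull_false k1 hq ?_
    rcases cov_bit k2 hmb with t | t | t
    · exact Or.inl (fld_bit hs t (by omega) (by omega) hm9)
    · exact Or.inr (Or.inr (fld_bit hs t (by omega) (by omega) hm9))
    · exact Or.inr (Or.inl (fld_bit hs t (by omega) (by omega) hm9))

/-- Points of the set are in the island `{0, i, ..., k}` or separated from it. -/
lemma island (hc : Cfg S p) {i k : ℕ} (hi : 0 < i) (hik : i < k) (hk : k < 9) {q : Pt}
    (hq : q ∈ S) : (∃ m, (m = 0 ∨ (i ≤ m ∧ m ≤ k)) ∧ q = p m) ∨ 0 < tri (p 0) (p k) q ∨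
      0 < tri (p i) (p 0) q := by
  rcases hc.far q hq with ⟨m, hm, rfl⟩ | h
  · rcases Nat.eq_zero_or_pos m with h0 | h0
    · exact Or.inl ⟨m, Or.inl h0, rfl⟩
    rcases lt_or_ge m i with h1 | h1
    · right; right
      rw [tri_rot (p m) (p i), tri_rot (p 0) (p m)]
      exact hc.root m i h0 h1 (by omega)
    rcases lt_or_ge k m with h2 | h2
    · right; left
      exact hc.root k m (by omega) h2 hm
    · exact Or.inl ⟨m, Or.inr ⟨h1, h2⟩, rfl⟩
  · exact Or.inr (Or.inl (h k (by omega) hk))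

lemma sideK (hc : Cfg S p) {i k m : ℕ} (hi : 0 < i) (hk : k < 9)
    (hm : m = 0 ∨ (i ≤ m ∧ m ≤ k)) : 0 ≤ tri (p k) (p 0) (p m) := by
  rcases hm with rfl | ⟨h1, h2⟩
  · simp
  rcases h2.eq_or_lt with rfl | h2
  · simp
  rw [tri_rot (p m) (p k), tri_rot (p 0) (p m)]
  exact (hc.root m k (by omega) h2 hk).le

lemma sideI (hc : Cfg S p) {i k m : ℕ} (hi : 0 < i) (hk : k < 9)
    (hm : m = 0 ∨ (i ≤ m ∧ m ≤ k)) : 0 ≤ tri (p 0) (p i) (p m) := by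
  rcases hm with rfl | ⟨h1, h2⟩
  · simp
  rcases h1.eq_or_lt with rfl | h1
  · simp
  exact (hc.root i m (by omega) h1 (by omega)).le

lemma hull_island (hc : Cfg S p) {i k x y z : ℕ} (hi : 0 < i) (hik : i < k) (hk : k < 9)
    (hx : x = 0 ∨ (i ≤ x ∧ x ≤ k)) (hy : y = 0 ∨ (i ≤ y ∧ y ≤ k)) (hz : z = 0 ∨ (i ≤ z ∧ z ≤ k))
    {q : Pt} (hq : q ∈ S) (hh : q ∈ convexHull ℝ ({p x, p y, p z} : Set Pt)) :
    ∃ m, (m = 0 ∨ (i ≤ m ∧ m ≤ k)) ∧ q = p m := by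
  rcases island hc hi hik hk hq with h | h | h
  · exact h
  · exact absurd h
      (hull_nonneg (sideK hc hi hk hx) (sideK hc hi hk hy) (sideK hc hi hk hz) hh)
  · exact absurd h
      (hull_nonneg (sideI hc hi hk hx) (sideI hc hi hk hy) (sideI hc hi hk hz) hh)

lemma empStep_sound0 (hc : Cfg S p) {i k : ℕ} (hi : 0 < i) (hik : i < k) (hk : k < 9) :
    Sound S p (empStep 0 i k (between i k)) := by
  refine empStep_sound_aux (by omega) (by omega) hk _ ?_ ?_
  · intro m hm; rw [mem_between] at hm; omega
  intro q hq hh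
  obtain ⟨m, hm, rfl⟩ := hull_island hc hi hik hk (Or.inl rfl) (Or.inr ⟨le_rfl, hik.le⟩)
    (Or.inr ⟨hik.le, le_rfl⟩) hq hh
  by_cases h0 : m = 0
  · left; simp [h0]
  by_cases h1 : m = i
  · left; simp [h1]
  by_cases h2 : m = k
  · left; simp [h2]
  right
  refine ⟨m, ?_, rfl⟩
  rw [mem_between]; omega

lemma empStep_sound1 (hc : Cfg S p) {i b k : ℕ} (hi : 0 < i) (hib : i < b) (hbk : b < k)
    (hk : k < 9) : Sound S p (empStep i b k ((between i k).filter (· ≠ b))) := by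
  refine empStep_sound_aux (by omega) (by omega) hk _ ?_ ?_
  · intro m hm
    rw [List.mem_filter, mem_between] at hm; omega
  intro q hq hh
  obtain ⟨m, hm, rfl⟩ := hull_island hc hi (hib.trans hbk) hk (Or.inr ⟨le_rfl, by omega⟩)
    (Or.inr ⟨by omega, by omega⟩) (Or.inr ⟨by omega, le_rfl⟩) hq hh
  by_cases h1 : m = i
  · left; simp [h1]
  by_cases h2 : m = k
  · left; simp [h2]
  by_cases h3 : m = b
  · left; simp [h3]
  right
  refine ⟨m, ?_, rfl⟩
  rw [List.mem_filter, mem_between]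
  have h0 : m ≠ 0 := by
    rintro rfl
    have e : ∀ x, tri (p 0) (p 0 + (p i - p k)) x = tri (p 0) (p i) x - tri (p 0) (p k) x := by
      intro x
      simp only [tri_def, Prod.fst_add, Prod.snd_add, Prod.fst_sub, Prod.snd_sub]; ring
    have r1 := hc.root i k hi (by omega) hk
    have r2 := hc.root i b hi (by omega) (by omega)
    have r3 := hc.root b k (by omega) (by omega) hk
    have := hull_pos (a := p 0) (b := p 0 + (p i - p k)) (by rw [e, tri_right, tri_swap']; linarith)
      (by rw [e, tri_swap' (p 0) (p b) (p k)]; linarith)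
      (by rw [e, tri_right]; linarith) hh
    simp at this
  refine ⟨by omega, by simpa using h3⟩

lemma hole_of_emp (H : Finset Pt) (hH : (H : Set Pt) ⊆ S) (hcard : H.card = 5)
    (hE : ∀ x ∈ H, ∀ y ∈ H, ∀ z ∈ H, x ≠ y → x ≠ z → y ≠ z → Emp S x y z) : HasHole 5 S := by
  classical
  have key : ∀ H' ⊆ H, 3 ≤ H'.card → ∀ q ∈ S, q ∈ convexHull ℝ (H' : Set Pt) → q ∈ H' := by
    intro H' hH' h3 q hq hh
    rw [convexHull_eq_union] at hh
    simp only [mem_iUnion] at hh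
    obtain ⟨t, ht, hind, hqt⟩ := hh
    have hc3 : t.card ≤ 3 := by
      have := hind.card_le_finrank_succ
      rw [Fintype.card_coe] at this
      refine this.trans ((Nat.add_le_add_right (Submodule.finrank_le _) 1).trans ?_)
      simp
    have ht' : t ⊆ H' := by exact_mod_cast ht
    obtain ⟨T, hT1, hT2, hT3⟩ := Finset.exists_subsuperset_card_eq ht' hc3 h3
    obtain ⟨x, y, z, hxy, hxz, hyz, rfl⟩ := Finset.card_eq_three.mp hT3
    have hx : x ∈ H' := hT2 (by simp)
    have hy : y ∈ H' := hT2 (by simp)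
    have hz : z ∈ H' := hT2 (by simp)
    have := hE x (hH' hx) y (hH' hy) z (hH' hz) hxy hxz hyz q hq
      (convexHull_mono (by intro u hu; simpa using hT1 hu) hqt)
    rcases this with rfl | rfl | rfl <;> assumption
  refine ⟨H, hH, by rw [Set.ncard_coe_finset, hcard], ?_, ?_⟩
  · intro x hx hx'
    rw [← Finset.coe_erase] at hx'
    have := key (H.erase x) (Finset.erase_subset _ _)
      (by rw [Finset.card_erase_of_mem (by simpa using hx), hcard]; norm_num) x (hH hx) hx'
    simp at this
  · intro q hq hq'
    exact key H le_rfl (by omega) q hq (interior_subset hq')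

lemma emp_swap {a b c : Pt} (h : Emp S a b c) : Emp S b a c := by
  unfold Emp at *; rwa [Set.insert_comm]

lemma emp_swap' {a b c : Pt} (h : Emp S a b c) : Emp S a c b := by
  unfold Emp at *; rwa [Set.pair_comm]

lemma holeStep_sound (hc : Cfg S p) (l : List ℕ) (hl : l.Nodup) (h5 : l.length = 5)
    (h9 : ∀ m ∈ l, m < 9) : Sound S p (holeStep l) := by
  classical
  intro f s hs h
  unfold holeStep doKill at h
  rcases bor_true h with h | h
  swap
  · exact Or.inr ⟨s, hs, h⟩
  left; left
  have h1 := inv_has hs h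
  have key : ∀ i ∈ l, ∀ j ∈ l, ∀ k ∈ l, i < j → j < k → Emp S (p i) (p j) (p k) := by
    intro i hi j hj k hk hij hjk
    rw [← mng_ebit (h9 i hi) (h9 j hj) (h9 k hk)]
    apply h1
    simp only [List.mem_flatMap]
    exact ⟨i, hi, j, hj, k, hk, by simp [hij, hjk]⟩
  refine hole_of_emp (l.toFinset.image p) ?_ ?_ ?_
  · intro x hx
    simp only [Finset.coe_image, List.coe_toFinset, mem_image, mem_ofPred_eq] at hx
    obtain ⟨m, hm, rfl⟩ := hx
    exact hc.mem m (h9 m hm)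
  · rw [Finset.card_image_of_injOn, List.toFinset_card_of_nodup hl, h5]
    intro x hx y hy hxy
    simp only [List.coe_toFinset, mem_ofPred_eq] at hx hy
    exact hc.inj x y (h9 x hx) (h9 y hy) hxy
  · intro x hx y hy z hz hxy hxz hyz
    simp only [Finset.mem_image, List.mem_toFinset] at hx hy hz
    obtain ⟨i, hi, rfl⟩ := hx
    obtain ⟨j, hj, rfl⟩ := hy
    obtain ⟨k, hk, rfl⟩ := hz
    have hij : i ≠ j := fun e => hxy (by rw [e])
    have hik : i ≠ k := fun e => hxz (by rw [e])
    have hjk : j ≠ k := fun e => hyz (by rw [e])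
    rcases lt_or_gt_of_ne hij with h1 | h1 <;> rcases lt_or_gt_of_ne hjk with h2 | h2 <;>
      rcases lt_or_gt_of_ne hik with h3 | h3
    · exact key i hi j hj k hk h1 h2
    · omega
    · exact emp_swap' (key i hi k hk j hj h3 h2)
    · exact emp_swap' (emp_swap (key k hk i hi j hj h3 h1))
    · exact emp_swap (key j hj i hi k hk h1 h3)
    · exact emp_swap (emp_swap' (key j hj k hk i hi h2 h3))
    · omega
    · exact emp_swap (emp_swap' (emp_swap (key k hk j hj i hi h2 h1)))

lemma ptStep_sound (hc : Cfg S p) {i k : ℕ} (hi : 0 < i) (hik : i < k) (hk : k < 9) (t : List ℕ) :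
    ∀ g ∈ ptStep i k t, Sound S p g := by
  intro g hg
  unfold ptStep at hg
  split at hg
  swap
  · simp at hg
  rename_i A a₁ a₂ B b C c
  split at hg
  swap
  · simp at hg
  rename_i hcond
  rw [List.mem_singleton] at hg
  subst hg
  obtain ⟨-, hin, hit, hkt⟩ := hcond
  have iA := hin A (by simp)
  have ia₁ := hin a₁ (by simp)
  have ia₂ := hin a₂ (by simp)
  have iB := hin B (by simp)
  have ib := hin b (by simp)
  have iC := hin C (by simp)
  have ic := hin c (by simp)
  have nA : A < 9 := by omega
  have na₁ : a₁ < 9 := by omega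
  have na₂ : a₂ < 9 := by omega
  have nB : B < 9 := by omega
  have nb : b < 9 := by omega
  have nC : C < 9 := by omega
  have nc : c < 9 := by omega
  intro f s hs h
  unfold doPt at h
  rcases bor_true h with h | h
  swap
  · exact Or.inr ⟨s, hs, h⟩
  left; right
  obtain ⟨hm, h⟩ := ite3_and h
  obtain ⟨har, hptc⟩ := ite3_and h
  have hm := inv_has hs hm
  have sg : PTSigns (p A) (p a₁) (p a₂) (p B) (p b) (p C) (p c) := by
    simp only [ptCore, List.forall_mem_cons, List.not_mem_nil, false_imp_iff, implies_true,
      and_true, mng_pbit, nA, na₁, na₂, nB, nb, nC, nc] at hm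
    obtain ⟨h1, h2, h3, h4, h5, h6, h7, h8, h9, h10, h11, h12, h13, h14, h15, h16, h17, h18, h19,
      h20⟩ := hm
    refine ⟨h1, h2, h3, h4, h5, h6, h7, h8, h9, h10, h11, h12, h13, h14, h15, h16, h17, h18, h19,
      h20, ?_⟩
    rcases bor_true har with h | h
    · have h := inv_has hs h
      simp only [List.forall_mem_cons, List.not_mem_nil, false_imp_iff, implies_true,
        and_true, mng_pbit, nA, na₁, na₂, nB, nb, nC, nc] at h
      exact Or.inl h
    · have h := inv_has hs h
      simp only [List.forall_mem_cons, List.not_mem_nil, false_imp_iff, implies_true,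
        and_true, mng_pbit, nA, na₁, na₂, nB, nb, nC, nc] at h
      exact Or.inr h
  refine ⟨poly7 (p A) (p a₁) (p a₂) (p B) (p b) (p C) (p c), ?_, poly7_pt sg, ?_⟩
  · rintro x ⟨j, rfl⟩
    revert j
    exact poly7_cases _ (hc.mem _ nA) (hc.mem _ na₁) (hc.mem _ na₂) (hc.mem _ nB) (hc.mem _ nb)
      (hc.mem _ nC) (hc.mem _ nc)
  · unfold EmptyIn
    rw [eq_empty_iff_forall_notMem]
    rintro q ⟨hq, hqS⟩
    revert hq
    rcases island hc hi hik hk hqS with ⟨m, hm, rfl⟩ | h | h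
    · by_cases hmt : m ∈ [A, a₁, a₂, B, b, C, c]
      · simp only [List.mem_cons, List.not_mem_nil, or_false] at hmt
        rcases hmt with rfl | rfl | rfl | rfl | rfl | rfl | rfl
        · exact vertex_not_interior _ 0
        · exact vertex_not_interior _ 1
        · exact vertex_not_interior _ 2
        · exact vertex_not_interior _ 3
        · exact vertex_not_interior _ 4
        · exact vertex_not_interior _ 5
        · exact vertex_not_interior _ 6
      · have hm9 : m < 9 := by omega
        have hb : (mk ((0 :: between i k).filter (· ∉ [A, a₁, a₂, B, b, C, c]))).testBit m
            = true := by
          rw [testBit_mk, List.mem_filter, List.mem_cons, mem_between]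
          refine ⟨?_, by simpa using hmt⟩
          have e1 : m ≠ i := by
            rintro rfl; exact hmt hit
          have e2 : m ≠ k := by
            rintro rfl; exact hmt hkt
          omega
        rcases ptc_bit hptc hb with ⟨x, y, z⟩ | ⟨x, y⟩ | ⟨x, y⟩
        · exact out_AB sg (fld_bit hs x (by omega) (by omega) hm9)
            (fld_bit hs y (by omega) (by omega) hm9) (fld_bit hs z (by omega) (by omega) hm9)
        · exact out_BC sg (fld_bit hs x (by omega) (by omega) hm9)
            (fld_bit hs y (by omega) (by omega) hm9)
        · exact out_CA sg (fld_bit hs x (by omega) (by omega) hm9)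
            (fld_bit hs y (by omega) (by omega) hm9)
    · refine not_interior_far h ?_
      have hh : ∀ m, (m = 0 ∨ (i ≤ m ∧ m ≤ k)) → tri (p 0) (p k) (p m) ≤ 0 := by
        intro m hm
        have := sideK hc hi hk hm
        rw [tri_swap] at this; linarith
      exact poly7_cases _ (hh _ iA) (hh _ ia₁) (hh _ ia₂) (hh _ iB) (hh _ ib) (hh _ iC) (hh _ ic)
    · refine not_interior_far h ?_
      have hh : ∀ m, (m = 0 ∨ (i ≤ m ∧ m ≤ k)) → tri (p i) (p 0) (p m) ≤ 0 := by
        intro m hm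
        have := sideI hc hi hk hm
        rw [tri_swap] at this; linarith
      exact poly7_cases _ (hh _ iA) (hh _ ia₁) (hh _ ia₂) (hh _ iB) (hh _ ib) (hh _ iC) (hh _ ic)

lemma steps_sound (hc : Cfg S p) : ∀ g ∈ steps, Sound S p g := by
  intro g hg
  unfold steps at hg
  simp only [List.mem_flatMap, List.mem_range, List.mem_reverse] at hg
  obtain ⟨k, hk, i, hik, hg⟩ := hg
  split at hg
  swap
  · simp at hg
  rename_i hi
  have hi : 0 < i := hi
  unfold block at hg
  simp only [List.mem_append, List.mem_map, List.mem_flatMap, List.mem_cons, List.not_mem_nil,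
    or_false, mem_between] at hg
  rcases hg with (((⟨j, hj, rfl⟩ | ⟨b, hb, rfl⟩) | rfl) | ⟨b, hb, c, hcc, rfl | ⟨d, hd, rfl⟩⟩) |
    ⟨n, -, hn⟩
  · exact brStep_sound hc hi hj.1 hj.2 hk
  · exact empStep_sound1 hc hi hb.1 hb.2 hk
  · exact empStep_sound0 hc hi hik hk
  · refine holeStep_sound hc _ ?_ rfl ?_
    · simp only [List.nodup_cons, List.mem_cons, List.not_mem_nil, or_false, not_or,
        not_false_eq_true, List.nodup_nil, and_true]
      omega
    · simp only [List.mem_cons, List.not_mem_nil, or_false]; omega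
  · refine holeStep_sound hc _ ?_ rfl ?_
    · simp only [List.nodup_cons, List.mem_cons, List.not_mem_nil, or_false, not_or,
        not_false_eq_true, List.nodup_nil, and_true]
      omega
    · simp only [List.mem_cons, List.not_mem_nil, or_false]; omega
  · exact ptStep_sound hc hi hik hk _ g hn

lemma start_inv (hc : Cfg S p) : Inv S p start0 := by
  unfold start0
  rw [inv_mk]
  intro v hv
  simp only [List.mem_flatMap, List.mem_range, mem_between] at hv
  obtain ⟨k, hk, j, hj, hv⟩ := hv
  have h := hc.root j k hj.1 hj.2 hk
  simp only [List.mem_cons, List.not_mem_nil, or_false] at hv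
  rcases hv with rfl | rfl | rfl
  · rwa [mng_pbit (by omega) (by omega) hk]
  · rwa [mng_pbit (by omega) hk (by omega), tri_rot]
  · rwa [mng_pbit hk (by omega) (by omega), tri_rot']

set_option maxRecDepth 100000 in
theorem run_ok : run steps start0 = true := by decide +kernel

theorem cfg_goal (hc : Cfg S p) : Goal S :=
  run_sound steps (steps_sound hc) start0 (start_inv hc) run_ok

end NinePts
namespace NinePts

lemma exists_min_rel (R : Pt → Pt → Prop) (T : Finset Pt) (hT : T.Nonempty)
    (htot : ∀ a ∈ T, ∀ b ∈ T, a ≠ b → R a b ∨ R b a)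
    (htr : ∀ a ∈ T, ∀ b ∈ T, ∀ c ∈ T, R a b → R b c → R a c) :
    ∃ m ∈ T, ∀ q ∈ T, q ≠ m → R m q := by
  induction hT using Finset.Nonempty.cons_induction with
  | singleton a => exact ⟨a, by simp, by simp⟩
  | cons a s ha hs ih =>
    obtain ⟨m, hm, hmin⟩ := ih
      (fun x hx y hy => htot x (Finset.mem_cons_of_mem hx) y (Finset.mem_cons_of_mem hy))
      (fun x hx y hy z hz => htr x (Finset.mem_cons_of_mem hx) y (Finset.mem_cons_of_mem hy)
        z (Finset.mem_cons_of_mem hz))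
    have hma : m ≠ a := fun e => ha (e ▸ hm)
    have hm' := Finset.mem_cons_of_mem (hb := ha) hm
    have ha' := Finset.mem_cons_self a s (h := ha)
    rcases htot m hm' a ha' hma with h | h
    · refine ⟨m, hm', fun q hq hqm => ?_⟩
      rcases Finset.mem_cons.mp hq with rfl | hq
      · exact h
      · exact hmin q hq hqm
    · refine ⟨a, ha', fun q hq hqa => ?_⟩
      rcases Finset.mem_cons.mp hq with rfl | hq
      · exact absurd rfl hqa
      · by_cases e : q = m
        · rw [e]; exact h
        · exact htr a ha' m hm' q (Finset.mem_cons_of_mem hq) h (hmin q hq e)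

lemma exists_sorted (R : Pt → Pt → Prop) (n : ℕ) : ∀ (T : Finset Pt), n ≤ T.card →
    (∀ a ∈ T, ∀ b ∈ T, a ≠ b → R a b ∨ R b a) →
    (∀ a ∈ T, ∀ b ∈ T, ∀ c ∈ T, R a b → R b c → R a c) →
    ∃ f : ℕ → Pt, (∀ i, i < n → f i ∈ T) ∧ (∀ i j, i < j → j < n → R (f i) (f j)) ∧
      ∀ q ∈ T, (∃ i, i < n ∧ q = f i) ∨ ∀ i, i < n → R (f i) q := by
  classical
  induction n with
  | zero =>
    intro T _ _ _
    exact ⟨fun _ => 0, by simp, by simp, by simp⟩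
  | succ n ih =>
    intro T hn htot htr
    obtain ⟨m, hm, hmin⟩ := exists_min_rel R T (Finset.card_pos.mp (by omega)) htot htr
    obtain ⟨f, h1, h2, h3⟩ := ih (T.erase m) (by rw [Finset.card_erase_of_mem hm]; omega)
      (fun x hx y hy => htot x (Finset.mem_of_mem_erase hx) y (Finset.mem_of_mem_erase hy))
      (fun x hx y hy z hz => htr x (Finset.mem_of_mem_erase hx) y (Finset.mem_of_mem_erase hy)
        z (Finset.mem_of_mem_erase hz))
    refine ⟨fun i => Nat.casesOn i m f, ?_, ?_, ?_⟩
    · rintro (_ | i) hi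
      · exact hm
      · exact Finset.mem_of_mem_erase (h1 i (by omega))
    · rintro (_ | i) (_ | j) hij hj
      · omega
      · have := h1 j (by omega)
        exact hmin _ (Finset.mem_of_mem_erase this) (Finset.ne_of_mem_erase this)
      · omega
      · exact h2 i j (by omega) (by omega)
    · intro q hq
      by_cases e : q = m
      · exact Or.inl ⟨0, by omega, e⟩
      rcases h3 q (Finset.mem_erase.mpr ⟨e, hq⟩) with ⟨i, hi, h⟩ | h
      · exact Or.inl ⟨i + 1, by omega, h⟩
      · right
        rintro (_ | i) hi
        · exact hmin q hq e
        · exact h i (by omega)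

lemma tri_trans (o a b c : Pt) (ha : o.1 < a.1 ∨ (o.1 = a.1 ∧ o.2 < a.2))
    (hb : o.1 < b.1 ∨ (o.1 = b.1 ∧ o.2 < b.2)) (hc : o.1 < c.1 ∨ (o.1 = c.1 ∧ o.2 < c.2))
    (h1 : 0 < tri o a b) (h2 : 0 < tri o b c) : 0 < tri o a c := by
  have e : (b.1 - o.1) * tri o a c = tri o a b * (c.1 - o.1) + tri o b c * (a.1 - o.1) := by
    simp only [tri_def]; ring
  rcases hb with hb | ⟨hb, hb'⟩
  · have ha' : 0 < a.1 - o.1 := by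
      rcases ha with ha | ⟨ha, ha'⟩
      · linarith
      · rw [tri_def, ← ha] at h1
        nlinarith [mul_pos (sub_pos.mpr ha') (sub_pos.mpr hb)]
    have hc' : 0 ≤ c.1 - o.1 := by
      rcases hc with hc | ⟨hc, -⟩ <;> linarith
    have : 0 < (b.1 - o.1) * tri o a c := by
      rw [e]
      have := mul_pos h2 ha'
      have := mul_nonneg h1.le hc'
      linarith
    exact (pos_iff_pos_of_mul_pos this).mp (by linarith)
  · exfalso
    rw [tri_def, ← hb] at h2
    have hc' : 0 ≤ c.1 - o.1 := by
      rcases hc with hc | ⟨hc, -⟩ <;> linarith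
    nlinarith [mul_nonneg (sub_pos.mpr hb').le hc']

lemma exists_cfg (S : Set Pt) (hfin : S.Finite) (hgp : GenPos S) (hcard : 9 ≤ S.ncard) :
    ∃ p, Cfg S p := by
  classical
  have hcf : 9 ≤ hfin.toFinset.card := by
    rwa [Set.ncard_eq_toFinset_card S hfin] at hcard
  obtain ⟨o, ho, hmin⟩ := hfin.toFinset.exists_min_image (fun x => toLex x)
    (Finset.card_pos.mp (by omega))
  have hoS : o ∈ S := by simpa using ho
  set T := hfin.toFinset.erase o with hT
  have hTS : ∀ x ∈ T, x ∈ S := fun x hx => by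
    simpa using Finset.mem_of_mem_erase hx
  have hTo : ∀ x ∈ T, x ≠ o := fun x hx => Finset.ne_of_mem_erase hx
  have hpos : ∀ x ∈ T, o.1 < x.1 ∨ (o.1 = x.1 ∧ o.2 < x.2) := by
    intro x hx
    have h := hmin x (Finset.mem_of_mem_erase hx)
    rw [Prod.Lex.le_iff] at h
    rcases h with h | ⟨h, h'⟩
    · exact Or.inl h
    · refine Or.inr ⟨h, lt_of_le_of_ne h' fun e => hTo x hx ?_⟩
      exact (Prod.ext h e).symm
  obtain ⟨f, h1, h2, h3⟩ := exists_sorted (fun a b => 0 < tri o a b) 8 T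
    (by rw [hT, Finset.card_erase_of_mem ho]; omega)
    (by
      intro a ha b hb hab
      rcases lt_or_gt_of_ne (tri_ne_zero hgp hoS (hTS a ha) (hTS b hb) (hTo a ha).symm
        (hTo b hb).symm hab) with h | h
      · right; rw [tri_swap']; linarith
      · left; exact h)
    (by
      intro a ha b hb c hc
      exact tri_trans o a b c (hpos a ha) (hpos b hb) (hpos c hc))
  have finj : ∀ i j, i < 8 → j < 8 → f i = f j → i = j := by
    intro i j hi hj e
    rcases lt_trichotomy i j with h | h | h
    · have := h2 i j h hj
      rw [e] at this; simp at this
    · exact h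
    · have := h2 j i h hi
      rw [e] at this; simp at this
  let p : ℕ → Pt := fun i => Nat.casesOn i o f
  have hmem : ∀ i, i < 9 → p i ∈ S := by
    rintro (_ | i) hi
    · exact hoS
    · exact hTS _ (h1 i (by omega))
  have hinj : ∀ i j, i < 9 → j < 9 → p i = p j → i = j := by
    rintro (_ | i) (_ | j) hi hj e
    · rfl
    · exact absurd (Eq.symm e) (hTo _ (h1 j (by omega)))
    · exact absurd e (hTo _ (h1 i (by omega)))
    · rw [finj i j (by omega) (by omega) e]
  refine ⟨p, hmem, hinj, ?_, ?_, ?_⟩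
  · rintro (_ | i) (_ | j) hi hij hj
    · omega
    · omega
    · omega
    · exact h2 i j (by omega) (by omega)
  · intro i j k hi hj hk hij hik hjk
    exact tri_ne_zero hgp (hmem i hi) (hmem j hj) (hmem k hk)
      (fun e => hij (hinj _ _ hi hj e)) (fun e => hik (hinj _ _ hi hk e))
      (fun e => hjk (hinj _ _ hj hk e))
  · intro q hq
    by_cases e : q = o
    · exact Or.inl ⟨0, by omega, e⟩
    rcases h3 q (Finset.mem_erase.mpr ⟨e, by simpa using hq⟩) with ⟨i, hi, h⟩ | h
    · exact Or.inl ⟨i + 1, by omega, h⟩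
    · right
      rintro (_ | k) hk hk'
      · omega
      · exact h k (by omega)

end NinePts

/-- every set of 9 points in general position contains a 5-hole or an
empty 7-pseudo-triangle. -/
theorem statement_9 (S : Set Pt) (hfin : S.Finite) (hgp : GenPos S)
    (hcard : 9 ≤ S.ncard) :
    HasHole 5 S ∨ HasEmptyPseudoTriangle 7 S := by
  obtain ⟨p, hp⟩ := NinePts.exists_cfg S hfin hgp hcard
  exact NinePts.cfg_goal hp
end
end

section
/- Let Z be a finite planar point set in general position such that at least 8 points of Z are vertices of the convex hull of Z and at most 4 points of Z lie in the interior of the convex hull of Z. Then Z contains a 6-hole. -/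
open Set

noncomputable section

/-- Orientation of a triple. -/
def ori (p q r : Pt) : ℝ := (q.1 - p.1) * (r.2 - p.2) - (q.2 - p.2) * (r.1 - p.1)

lemma ori_ne {Z : Set Pt} (hgp : GenPos Z) {p q r : Pt} (hp : p ∈ Z) (hq : q ∈ Z) (hr : r ∈ Z)
    (h1 : p ≠ q) (h2 : p ≠ r) (h3 : q ≠ r) : ori p q r ≠ 0 := by
  intro h
  apply hgp p hp q hq r hr h1 h2 h3
  rw [collinear_iff_of_mem (p₀ := p) (by simp)]
  refine ⟨q - p, ?_⟩
  intro x hx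
  simp only [mem_insert_iff, mem_singleton_iff] at hx
  rcases hx with rfl | rfl | rfl
  · exact ⟨0, by simp⟩
  · exact ⟨1, by simp⟩
  · unfold ori at h
    by_cases hc : q.1 - p.1 = 0
    · have hd : q.2 - p.2 ≠ 0 := by
        intro hd
        exact h1 (Prod.ext (by linarith) (by linarith))
      refine ⟨(x.2 - p.2) / (q.2 - p.2), ?_⟩
      have : x.1 - p.1 = 0 := by
        rw [hc] at h
        have : (q.2 - p.2) * (x.1 - p.1) = 0 := by linarith
        exact (mul_eq_zero.mp this).resolve_left hd
      ext
      · simp [hc]; linarith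
      · simp; field_simp; ring
    · refine ⟨(x.1 - p.1) / (q.1 - p.1), ?_⟩
      ext
      · simp; field_simp; ring
      · simp; field_simp; linarith

lemma ori_comb (p q x y : Pt) (s t : ℝ) (h : s + t = 1) :
    ori p q (s • x + t • y) = s * ori p q x + t * ori p q y := by
  have : s = 1 - t := by linarith
  subst this
  simp [ori]; ring

/-- A point that lies on a line supporting the rest is not in the hull of the rest. -/
lemma not_mem_hull {H : Set Pt} {p q : Pt} (σ : ℝ) (hpq : q ≠ p)
    (h : ∀ r ∈ H, r ≠ p → r ≠ q → 0 < σ * ori p q r) : p ∉ convexHull ℝ (H \ {p}) := by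
  let g : Pt → ℝ := fun x => (q.1 - p.1) * (x.1 - p.1) + (q.2 - p.2) * (x.2 - p.2)
  let C : Set Pt := {x | 0 < σ * ori p q x ∨ (σ * ori p q x = 0 ∧ 0 < g x)}
  have hC : Convex ℝ C := by
    rw [convex_iff_forall_pos]
    intro x hx y hy s t hs ht hst
    have hg : g (s • x + t • y) = s * g x + t * g y := by
      have : s = 1 - t := by linarith
      subst this
      simp [g]; ring
    have ho : σ * ori p q (s • x + t • y) = s * (σ * ori p q x) + t * (σ * ori p q y) := by
      rw [ori_comb _ _ _ _ _ _ hst]; ring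
    simp only [C, mem_ofPred_eq] at hx hy ⊢
    rw [ho, hg]
    rcases hx with hx | ⟨hx, hx'⟩ <;> rcases hy with hy | ⟨hy, hy'⟩
    · left; positivity
    · left; rw [hy]; simp; positivity
    · left; rw [hx]; simp; positivity
    · right; rw [hx, hy]; exact ⟨by simp, by positivity⟩
  have hsub : H \ {p} ⊆ C := by
    rintro r ⟨hr, hrp⟩
    by_cases hrq : r = q
    · subst hrq
      right
      refine ⟨by simp [ori]; right; ring, ?_⟩
      have : r.1 - p.1 ≠ 0 ∨ r.2 - p.2 ≠ 0 := by
        by_contra hcon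
        push Not at hcon
        exact hpq (Prod.ext (by linarith) (by linarith))
      rcases this with h0 | h0
      · have := mul_self_pos.mpr h0
        simp only [g]; nlinarith [mul_self_nonneg (r.2 - p.2)]
      · have := mul_self_pos.mpr h0
        simp only [g]; nlinarith [mul_self_nonneg (r.1 - p.1)]
    · left; exact h r hr hrp hrq
  intro hp
  have := convexHull_min hsub hC hp
  simp [C, g, ori] at this

lemma not_mem_hull_side {H : Set Pt} {p q s : Pt} (σ : ℝ)
    (h : ∀ r ∈ H, 0 ≤ σ * ori p q r) (hs : σ * ori p q s < 0) : s ∉ convexHull ℝ H := by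
  let C : Set Pt := {x | 0 ≤ σ * ori p q x}
  have hC : Convex ℝ C := by
    rw [convex_iff_forall_pos]
    intro x hx y hy s t hs ht hst
    have ho : σ * ori p q (s • x + t • y) = s * (σ * ori p q x) + t * (σ * ori p q y) := by
      rw [ori_comb _ _ _ _ _ _ hst]; ring
    simp only [C, mem_ofPred_eq] at hx hy ⊢
    rw [ho]; positivity
  intro hp
  have : s ∈ C := convexHull_min h hC hp
  simp only [C, mem_ofPred_eq] at this
  linarith

lemma mem_tri {a b c x : Pt} (σ : ℝ) (h1 : 0 < σ * ori a b x) (h2 : 0 < σ * ori b c x)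
    (h3 : 0 < σ * ori c a x) : x ∈ convexHull ℝ ({a, b, c} : Set Pt) := by
  set u := σ * ori a b x with hu
  set v := σ * ori b c x with hv
  set w := σ * ori c a x with hw
  have hs : 0 < u + v + w := by positivity
  have hx : x = (v / (u + v + w)) • a + (w / (u + v + w)) • b + (u / (u + v + w)) • c := by
    ext
    · simp
      field_simp
      rw [hu, hv, hw]; unfold ori; ring
    · simp
      field_simp
      rw [hu, hv, hw]; unfold ori; ring
  rw [hx]
  have hc := convex_convexHull ℝ ({a, b, c} : Set Pt)
  have := hc.sum_mem (t := Finset.univ) (w := ![v / (u + v + w), w / (u + v + w), u / (u + v + w)])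
    (z := ![a, b, c]) (by intro i _; fin_cases i <;> simp <;> positivity)
    (by simp [Fin.sum_univ_three]; field_simp; ring)
    (by intro i _; fin_cases i <;> simp <;> apply subset_convexHull <;> simp)
  simpa [Fin.sum_univ_three] using this

lemma ori_cont (p q : Pt) : Continuous (ori p q) := by
  unfold ori; fun_prop

lemma mem_interior_of {Z : Set Pt} (hgp : GenPos Z) {p : Pt} (hp : p ∈ Z)
    (h : p ∈ convexHull ℝ (Z \ {p})) : p ∈ interior (convexHull ℝ Z) := by
  obtain ⟨ι, _, z, w, hz, hind, hw, hw1, hwp⟩ := eq_pos_convex_span_of_mem_convexHull h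
  have hcard : Fintype.card ι ≤ 3 := by
    have h1 := hind.card_le_finrank_succ
    have h3 : Module.finrank ℝ Pt = 2 := by simp [Pt]
    have h4 := h1.trans (Nat.succ_le_succ (Submodule.finrank_le _))
    rw [h3] at h4
    exact h4
  have hinj := hind.injective
  have hzZ : ∀ i, z i ∈ Z ∧ z i ≠ p := fun i => by
    have := hz (mem_range_self i)
    exact ⟨this.1, this.2⟩
  obtain ⟨n, hn⟩ : ∃ n, Fintype.card ι = n := ⟨_, rfl⟩
  let e := (Fintype.equivFinOfCardEq hn).symm
  rw [← e.sum_comp] at hw1 hwp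
  have hne : ∀ i j, i ≠ j → z (e i) ≠ z (e j) := fun i j hij hh => hij (e.injective (hinj hh))
  rw [hn] at hcard
  interval_cases n
  · simp at hw1
  · simp at hw1 hwp
    exact absurd (by simpa [hw1] using hwp) (hzZ _).2
  · simp only [Fin.sum_univ_two] at hw1 hwp
    exfalso
    have := ori_ne hgp (hzZ (e 0)).1 (hzZ (e 1)).1 hp (hne 0 1 (by simp)) (hzZ _).2 (hzZ _).2
    apply this
    rw [← hwp, ori_comb _ _ _ _ _ _ hw1]
    unfold ori; ring
  · simp only [Fin.sum_univ_three] at hw1 hwp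
    have h0 := hw (e 0)
    have h1 := hw (e 1)
    have h2 := hw (e 2)
    have hz0 := (hzZ (e 0)).1
    have hz1 := (hzZ (e 1)).1
    have hz2 := (hzZ (e 2)).1
    have n01 := hne 0 1 (by simp)
    have n02 := hne 0 2 (by simp)
    have n12 := hne 1 2 (by simp)
    generalize z (e 0) = a at *
    generalize z (e 1) = b at *
    generalize z (e 2) = c at *
    generalize w (e 0) = u at *
    generalize w (e 1) = v at *
    generalize w (e 2) = t at *
    have ho := ori_ne hgp hz0 hz1 hz2 n01 n02 n12
    have hu : u = 1 - v - t := by linarith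
    have hsq := mul_self_pos.mpr ho
    let σ := ori a b c
    have k1 : 0 < σ * ori a b p := by
      have : σ * ori a b p = t * (ori a b c * ori a b c) := by
        rw [← hwp, hu]; simp [σ, ori]; ring
      rw [this]; positivity
    have k2 : 0 < σ * ori b c p := by
      have : σ * ori b c p = u * (ori a b c * ori a b c) := by
        rw [← hwp, hu]; simp [σ, ori]; ring
      rw [this]; positivity
    have k3 : 0 < σ * ori c a p := by
      have : σ * ori c a p = v * (ori a b c * ori a b c) := by
        rw [← hwp, hu]; simp [σ, ori]; ring
      rw [this]; positivity
    rw [mem_interior]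
    refine ⟨{x | 0 < σ * ori a b x} ∩ {x | 0 < σ * ori b c x} ∩ {x | 0 < σ * ori c a x},
      ?_, ?_, ⟨⟨k1, k2⟩, k3⟩⟩
    · rintro x ⟨⟨x1, x2⟩, x3⟩
      refine convexHull_mono ?_ (mem_tri σ x1 x2 x3)
      rintro y (rfl | rfl | rfl) <;> assumption
    · refine IsOpen.inter (IsOpen.inter ?_ ?_) ?_ <;>
        exact isOpen_lt continuous_const (continuous_const.mul (ori_cont _ _))

lemma mk_hole {Z : Set Pt} (A T : Finset Pt) (hA : ∀ p ∈ A, p ∈ Z ∧ p ∉ hullVertices Z)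
    (hT : ∀ p ∈ T, p ∈ hullVertices Z) (hc : A.card + T.card = 6)
    (h1 : ∀ p ∈ A, ∃ q ∈ A ∪ T, q ≠ p ∧ ∃ σ : ℝ, ∀ r ∈ A ∪ T, r ≠ p → r ≠ q → 0 < σ * ori p q r)
    (h2 : ∀ s ∈ Z, s ∉ hullVertices Z → s ∉ A → ∃ p q, ∃ σ : ℝ,
      (∀ r ∈ A ∪ T, 0 ≤ σ * ori p q r) ∧ σ * ori p q s < 0) : HasHole 6 Z := by
  have hsub : ((A ∪ T : Finset Pt) : Set Pt) ⊆ Z := by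
    intro x hx
    simp only [Finset.coe_union, mem_union, Finset.mem_coe] at hx
    rcases hx with hx | hx
    · exact (hA x hx).1
    · exact (hT x hx).1
  refine ⟨((A ∪ T : Finset Pt) : Set Pt), hsub, ?_, ?_, ?_⟩
  · rw [Set.ncard_coe_finset, Finset.card_union_of_disjoint, hc]
    rw [Finset.disjoint_left]
    intro x hx hx'
    exact (hA x hx).2 (hT x hx')
  · intro p hp
    by_cases hpA : p ∈ A
    · obtain ⟨q, hq, hqp, σ, hσ⟩ := h1 p hpA
      exact not_mem_hull σ hqp (fun r hr => hσ r (by exact_mod_cast hr))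
    · have hpT : p ∈ T := by
        have : p ∈ A ∪ T := by exact_mod_cast hp
        simpa [hpA] using this
      intro hh
      exact (hT p hpT).2 (convexHull_mono (sdiff_subset_sdiff_left hsub) hh)
  · intro s hs hsi
    have hsc := interior_subset hsi
    by_contra hsn
    by_cases hsV : s ∈ hullVertices Z
    · have hs2 : ((A ∪ T : Finset Pt) : Set Pt) ⊆ Z \ {s} := by
        intro x hx
        refine ⟨hsub hx, ?_⟩
        rintro rfl
        exact hsn hx
      exact hsV.2 (convexHull_mono hs2 hsc)
    · obtain ⟨p, q, σ, ha, hb⟩ := h2 s hs hsV (fun h => hsn (by simp [h]))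
      exact not_mem_hull_side σ (fun r hr => ha r (by exact_mod_cast hr)) hb hsc

/-- The part of `Z` that is not a hull vertex. -/
def Inn (Z : Set Pt) (p : Pt) : Prop := p ∈ Z ∧ p ∉ hullVertices Z

lemma ori_ne_v {Z : Set Pt} (hgp : GenPos Z) {a b v : Pt} (ha : Inn Z a) (hb : Inn Z b)
    (hab : a ≠ b) (hv : v ∈ hullVertices Z) : ori a b v ≠ 0 := by
  refine ori_ne hgp ha.1 hb.1 hv.1 hab ?_ ?_
  · rintro rfl; exact ha.2 hv
  · rintro rfl; exact hb.2 hv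

/-- A supporting line of the inner points through two of them. -/
lemma edge_le {Z : Set Pt} (hno : ¬ HasHole 6 Z) {V : Finset Pt}
    (hV : ∀ p, p ∈ V ↔ p ∈ hullVertices Z) {a b : Pt} (ha : Inn Z a) (hb : Inn Z b)
    (hab : a ≠ b) (σ : ℝ) (h : ∀ s, Inn Z s → s ≠ a → s ≠ b → σ * ori a b s < 0) :
    (V.filter fun v => 0 < σ * ori a b v).card ≤ 3 := by
  by_contra hcon
  push Not at hcon
  obtain ⟨T, hTs, hT⟩ := Finset.exists_subset_card_eq (Nat.succ_le_of_lt hcon)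
  have hT' : ∀ v ∈ T, v ∈ hullVertices Z ∧ 0 < σ * ori a b v := by
    intro v hv
    have := hTs hv
    rwa [Finset.mem_filter, hV] at this
  have e1 : ori a b a = 0 := by unfold ori; ring
  have e2 : ori a b b = 0 := by unfold ori; ring
  apply hno
  refine mk_hole {a, b} T ?_ (fun v hv => (hT' v hv).1) ?_ ?_ ?_
  · simp only [Finset.mem_insert, Finset.mem_singleton]
    rintro p (rfl | rfl)
    · exact ha
    · exact hb
  · rw [Finset.card_pair hab, hT]
  · simp only [Finset.mem_insert, Finset.mem_singleton, Finset.mem_union]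
    rintro p (rfl | rfl)
    · refine ⟨b, by simp, hab.symm, σ, ?_⟩
      rintro r ((rfl | rfl) | hr) k1 k2
      · exact absurd rfl k1
      · exact absurd rfl k2
      · exact (hT' r hr).2
    · refine ⟨a, by simp, hab, -σ, ?_⟩
      rintro r ((rfl | rfl) | hr) k1 k2
      · exact absurd rfl k2
      · exact absurd rfl k1
      · have h5 := (hT' r hr).2
        have h6 : -σ * ori p a r = σ * ori a p r := by unfold ori; ring
        rwa [h6]
  · intro s hs hsV hsA
    simp only [Finset.mem_insert, Finset.mem_singleton, not_or] at hsA
    refine ⟨a, b, σ, ?_, h s ⟨hs, hsV⟩ hsA.1 hsA.2⟩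
    simp only [Finset.mem_insert, Finset.mem_singleton, Finset.mem_union]
    rintro r ((rfl | rfl) | hr)
    · simp [e1]
    · simp [e2]
    · exact (hT' r hr).2.le

/-- An inner triangle, with vertices lying in the angle at `d` of the triangle `d a b`. -/
lemma wedge_le {Z : Set Pt} (hno : ¬ HasHole 6 Z) {V : Finset Pt}
    (hV : ∀ p, p ∈ V ↔ p ∈ hullVertices Z) {a b d : Pt} (ha : Inn Z a) (hb : Inn Z b)
    (hd : Inn Z d) (hab : a ≠ b) (had : a ≠ d) (hbd : b ≠ d) (h0 : 0 < ori d a b)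
    (h : ∀ s, Inn Z s → s ≠ a → s ≠ b → s ≠ d → ori d a s < 0) :
    (V.filter fun v => 0 < ori d a v ∧ ori d b v < 0).card ≤ 2 := by
  by_contra hcon
  push Not at hcon
  obtain ⟨T, hTs, hT⟩ := Finset.exists_subset_card_eq (Nat.succ_le_of_lt hcon)
  have hT' : ∀ v ∈ T, v ∈ hullVertices Z ∧ 0 < ori d a v ∧ ori d b v < 0 := by
    intro v hv
    have := hTs hv
    rwa [Finset.mem_filter, hV] at this
  apply hno
  refine mk_hole {a, b, d} T ?_ (fun v hv => (hT' v hv).1) ?_ ?_ ?_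
  · simp only [Finset.mem_insert, Finset.mem_singleton]
    rintro p (rfl | rfl | rfl) <;> assumption
  · rw [Finset.card_eq_three.mpr ⟨a, b, d, hab, had, hbd, rfl⟩, hT]
  · simp only [Finset.mem_insert, Finset.mem_singleton, Finset.mem_union]
    rintro p (rfl | rfl | rfl)
    · refine ⟨d, by simp, had.symm, -1, ?_⟩
      rintro r ((rfl | rfl | rfl) | hr) k1 k2
      · exact absurd rfl k1
      · unfold ori at *; linarith
      · exact absurd rfl k2
      · have := (hT' r hr).2.1
        unfold ori at *; linarith
    · refine ⟨d, by simp, hbd.symm, 1, ?_⟩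
      rintro r ((rfl | rfl | rfl) | hr) k1 k2
      · unfold ori at *; linarith
      · exact absurd rfl k1
      · exact absurd rfl k2
      · have := (hT' r hr).2.2
        unfold ori at *; linarith
    · refine ⟨a, by simp, had, 1, ?_⟩
      rintro r ((rfl | rfl | rfl) | hr) k1 k2
      · exact absurd rfl k2
      · linarith
      · exact absurd rfl k1
      · have := (hT' r hr).2.1
        linarith
  · intro s hs hsV hsA
    simp only [Finset.mem_insert, Finset.mem_singleton, not_or] at hsA
    refine ⟨d, a, 1, ?_, by
      have := h s ⟨hs, hsV⟩ hsA.1 hsA.2.1 hsA.2.2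
      linarith⟩
    simp only [Finset.mem_insert, Finset.mem_singleton, Finset.mem_union]
    rintro r ((rfl | rfl | rfl) | hr)
    · unfold ori; linarith
    · linarith
    · unfold ori; linarith
    · have := (hT' r hr).2.1
      linarith

/-- An inner quadrilateral: vertices beyond neither of two opposite edges. -/
lemma strip_le {Z : Set Pt} (hno : ¬ HasHole 6 Z) {V : Finset Pt}
    (hV : ∀ p, p ∈ V ↔ p ∈ hullVertices Z) {a b c d : Pt} (ha : Inn Z a) (hb : Inn Z b)
    (hc : Inn Z c) (hd : Inn Z d) (hab : a ≠ b) (hac : a ≠ c) (had : a ≠ d) (hbc : b ≠ c)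
    (hbd : b ≠ d) (hcd : c ≠ d) (h1 : 0 < ori a b c) (h2 : 0 < ori b c d) (h3 : 0 < ori c d a)
    (h4 : 0 < ori d a b) (h : ∀ s, Inn Z s → s = a ∨ s = b ∨ s = c ∨ s = d) :
    (V.filter fun v => 0 < ori b c v ∧ 0 < ori d a v).card ≤ 1 := by
  by_contra hcon
  push Not at hcon
  obtain ⟨T, hTs, hT⟩ := Finset.exists_subset_card_eq (Nat.succ_le_of_lt hcon)
  have hT' : ∀ v ∈ T, v ∈ hullVertices Z ∧ 0 < ori b c v ∧ 0 < ori d a v := by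
    intro v hv
    have := hTs hv
    rwa [Finset.mem_filter, hV] at this
  apply hno
  refine mk_hole {a, b, c, d} T ?_ (fun v hv => (hT' v hv).1) ?_ ?_ ?_
  · simp only [Finset.mem_insert, Finset.mem_singleton]
    rintro p (rfl | rfl | rfl | rfl) <;> assumption
  · rw [hT, Finset.card_insert_of_notMem (by simp [*]),
      Finset.card_eq_three.mpr ⟨b, c, d, hbc, hbd, hcd, rfl⟩]
  · simp only [Finset.mem_insert, Finset.mem_singleton, Finset.mem_union]
    rintro p (rfl | rfl | rfl | rfl)
    · refine ⟨d, by simp, had.symm, -1, ?_⟩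
      rintro r ((rfl | rfl | rfl | rfl) | hr) k1 k2
      · exact absurd rfl k1
      · unfold ori at *; linarith
      · unfold ori at *; linarith
      · exact absurd rfl k2
      · have := (hT' r hr).2.2
        unfold ori at *; linarith
    · refine ⟨c, by simp, hbc.symm, 1, ?_⟩
      rintro r ((rfl | rfl | rfl | rfl) | hr) k1 k2
      · unfold ori at *; linarith
      · exact absurd rfl k1
      · exact absurd rfl k2
      · linarith
      · have := (hT' r hr).2.1
        linarith
    · refine ⟨b, by simp, hbc, -1, ?_⟩
      rintro r ((rfl | rfl | rfl | rfl) | hr) k1 k2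
      · unfold ori at *; linarith
      · exact absurd rfl k2
      · exact absurd rfl k1
      · unfold ori at *; linarith
      · have := (hT' r hr).2.1
        unfold ori at *; linarith
    · refine ⟨a, by simp, had, 1, ?_⟩
      rintro r ((rfl | rfl | rfl | rfl) | hr) k1 k2
      · exact absurd rfl k2
      · unfold ori at *; linarith
      · unfold ori at *; linarith
      · exact absurd rfl k1
      · have := (hT' r hr).2.2
        linarith
  · intro s hs hsV hsA
    exact absurd (by simpa using h s ⟨hs, hsV⟩) hsA

lemma quad_case {Z : Set Pt} (hgp : GenPos Z) (hno : ¬ HasHole 6 Z) {V : Finset Pt}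
    (hV : ∀ p, p ∈ V ↔ p ∈ hullVertices Z) (h8 : 8 ≤ V.card)
    {a b c d : Pt} (ha : Inn Z a) (hb : Inn Z b)
    (hc : Inn Z c) (hd : Inn Z d) (hab : a ≠ b) (hac : a ≠ c) (had : a ≠ d) (hbc : b ≠ c)
    (hbd : b ≠ d) (hcd : c ≠ d) (h : ∀ s, Inn Z s → s = a ∨ s = b ∨ s = c ∨ s = d)
    (h1 : 0 < ori a b c) (h2 : 0 < ori b c d) (h3 : 0 < ori c d a)
    (h4 : 0 < ori d a b) : False := by
  have s1 := strip_le hno hV ha hb hc hd hab hac had hbc hbd hcd h1 h2 h3 h4 h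
  have s2 := strip_le hno hV hb hc hd ha hbc hbd hab.symm hcd hac.symm had.symm h2 h3 h4 h1
    (by intro s hs; have := h s hs; tauto)
  have e1 := edge_le hno hV ha hb hab (-1) (by
    intro s hs k1 k2
    rcases h s hs with rfl | rfl | rfl | rfl
    · exact absurd rfl k1
    · exact absurd rfl k2
    · unfold ori at *; linarith
    · unfold ori at *; linarith)
  have e2 := edge_le hno hV hb hc hbc (-1) (by
    intro s hs k1 k2
    rcases h s hs with rfl | rfl | rfl | rfl
    · unfold ori at *; linarith
    · exact absurd rfl k1
    · exact absurd rfl k2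
    · unfold ori at *; linarith)
  have e3 := edge_le hno hV hc hd hcd (-1) (by
    intro s hs k1 k2
    rcases h s hs with rfl | rfl | rfl | rfl
    · unfold ori at *; linarith
    · unfold ori at *; linarith
    · exact absurd rfl k1
    · exact absurd rfl k2)
  have e4 := edge_le hno hV hd ha had.symm (-1) (by
    intro s hs k1 k2
    rcases h s hs with rfl | rfl | rfl | rfl
    · exact absurd rfl k2
    · unfold ori at *; linarith
    · unfold ori at *; linarith
    · exact absurd rfl k1)
  simp only [Finset.card_filter] at s1 s2 e1 e2 e3 e4
  have key : ∑ v ∈ V, 2 ≤ ∑ v ∈ V, ((if 0 < ori b c v ∧ 0 < ori d a v then 1 else 0) +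
      (if 0 < ori c d v ∧ 0 < ori a b v then 1 else 0) +
      (if 0 < -1 * ori a b v then 1 else 0) + (if 0 < -1 * ori b c v then 1 else 0) +
      (if 0 < -1 * ori c d v then 1 else 0) + (if 0 < -1 * ori d a v then 1 else 0)) := by
    apply Finset.sum_le_sum
    intro v hv
    rw [hV] at hv
    have n1 := ori_ne_v hgp ha hb hab hv
    have n2 := ori_ne_v hgp hb hc hbc hv
    have n3 := ori_ne_v hgp hc hd hcd hv
    have n4 := ori_ne_v hgp hd ha had.symm hv
    rcases lt_or_gt_of_ne n1 with m1 | m1 <;> rcases lt_or_gt_of_ne n2 with m2 | m2 <;>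
    rcases lt_or_gt_of_ne n3 with m3 | m3 <;> rcases lt_or_gt_of_ne n4 with m4 | m4 <;>
      simp [m1, m2, m3, m4, m1.not_gt, m2.not_gt, m3.not_gt, m4.not_gt]
  simp only [Finset.sum_add_distrib, Finset.sum_const, smul_eq_mul] at key
  omega

lemma star_case {Z : Set Pt} (hgp : GenPos Z) (hno : ¬ HasHole 6 Z) {V : Finset Pt}
    (hV : ∀ p, p ∈ V ↔ p ∈ hullVertices Z) (h8 : 8 ≤ V.card)
    {a b c d : Pt} (ha : Inn Z a) (hb : Inn Z b)
    (hc : Inn Z c) (hd : Inn Z d) (hab : a ≠ b) (hac : a ≠ c) (had : a ≠ d) (hbc : b ≠ c)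
    (hbd : b ≠ d) (hcd : c ≠ d) (h : ∀ s, Inn Z s → s = a ∨ s = b ∨ s = c ∨ s = d)
    (h1 : 0 < ori d a b) (h2 : 0 < ori d b c) (h3 : 0 < ori d c a) : False := by
  have e1 := wedge_le hno hV ha hb hd hab had hbd h1 (by
    intro s hs k1 k2 k3
    rcases h s hs with rfl | rfl | rfl | rfl
    · exact absurd rfl k1
    · exact absurd rfl k2
    · unfold ori at *; linarith
    · exact absurd rfl k3)
  have e2 := wedge_le hno hV hb hc hd hbc hbd hcd h2 (by
    intro s hs k1 k2 k3
    rcases h s hs with rfl | rfl | rfl | rfl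
    · unfold ori at *; linarith
    · exact absurd rfl k1
    · exact absurd rfl k2
    · exact absurd rfl k3)
  have e3 := wedge_le hno hV hc ha hd hac.symm hcd had h3 (by
    intro s hs k1 k2 k3
    rcases h s hs with rfl | rfl | rfl | rfl
    · exact absurd rfl k2
    · unfold ori at *; linarith
    · exact absurd rfl k1
    · exact absurd rfl k3)
  simp only [Finset.card_filter] at e1 e2 e3
  have key : ∑ v ∈ V, 1 ≤ ∑ v ∈ V, ((if 0 < ori d a v ∧ ori d b v < 0 then 1 else 0) +
      (if 0 < ori d b v ∧ ori d c v < 0 then 1 else 0) +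
      (if 0 < ori d c v ∧ ori d a v < 0 then 1 else 0)) := by
    apply Finset.sum_le_sum
    intro v hv
    rw [hV] at hv
    have n1 := ori_ne_v hgp hd ha had.symm hv
    have n2 := ori_ne_v hgp hd hb hbd.symm hv
    have n3 := ori_ne_v hgp hd hc hcd.symm hv
    have id : ori d b c * ori d a v + ori d c a * ori d b v + ori d a b * ori d c v = 0 := by
      unfold ori; ring
    rcases lt_or_gt_of_ne n1 with m1 | m1 <;> rcases lt_or_gt_of_ne n2 with m2 | m2 <;>
    rcases lt_or_gt_of_ne n3 with m3 | m3
    · have := mul_neg_of_pos_of_neg h2 m1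
      have := mul_neg_of_pos_of_neg h3 m2
      have := mul_neg_of_pos_of_neg h1 m3
      linarith
    all_goals try simp [m1, m2, m3, m1.not_gt, m2.not_gt, m3.not_gt]
    have := mul_pos h2 m1
    have := mul_pos h3 m2
    have := mul_pos h1 m3
    linarith
  simp only [Finset.sum_add_distrib, Finset.sum_const, smul_eq_mul] at key
  omega

lemma three_case {Z : Set Pt} (hgp : GenPos Z) (hno : ¬ HasHole 6 Z) {V : Finset Pt}
    (hV : ∀ p, p ∈ V ↔ p ∈ hullVertices Z) (h8 : 8 ≤ V.card)
    {a b c : Pt} (ha : Inn Z a) (hb : Inn Z b)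
    (hc : Inn Z c) (hab : a ≠ b) (hac : a ≠ c) (hbc : b ≠ c)
    (h : ∀ s, Inn Z s → s = a ∨ s = b ∨ s = c)
    (h1 : 0 < ori a b c) : False := by
  have s1 := wedge_le hno hV ha hb hc hab hac hbc (by unfold ori at *; linarith) (by
    intro s hs k1 k2 k3
    have := h s hs
    tauto)
  have s2 := wedge_le hno hV hb hc ha hbc hab.symm hac.symm h1 (by
    intro s hs k1 k2 k3
    have := h s hs
    tauto)
  have s3 := wedge_le hno hV hc ha hb hac.symm hbc.symm hab (by unfold ori at *; linarith) (by
    intro s hs k1 k2 k3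
    have := h s hs
    tauto)
  have e1 := edge_le hno hV ha hb hab (-1) (by
    intro s hs k1 k2
    rcases h s hs with rfl | rfl | rfl
    · exact absurd rfl k1
    · exact absurd rfl k2
    · linarith)
  have e2 := edge_le hno hV hb hc hbc (-1) (by
    intro s hs k1 k2
    rcases h s hs with rfl | rfl | rfl
    · unfold ori at *; linarith
    · exact absurd rfl k1
    · exact absurd rfl k2)
  have e3 := edge_le hno hV hc ha hac.symm (-1) (by
    intro s hs k1 k2
    rcases h s hs with rfl | rfl | rfl
    · exact absurd rfl k2
    · unfold ori at *; linarith
    · exact absurd rfl k1)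
  have r1 : ∀ v, ori c b v = - ori b c v := fun v => by unfold ori; ring
  have r2 : ∀ v, ori a c v = - ori c a v := fun v => by unfold ori; ring
  have r3 : ∀ v, ori b a v = - ori a b v := fun v => by unfold ori; ring
  simp only [Finset.card_filter, r1, r2, r3] at s1 s2 s3 e1 e2 e3
  have key : ∑ v ∈ V, 2 ≤ ∑ v ∈ V, ((if 0 < ori c a v ∧ - ori b c v < 0 then 1 else 0) +
      (if 0 < ori a b v ∧ - ori c a v < 0 then 1 else 0) +
      (if 0 < ori b c v ∧ - ori a b v < 0 then 1 else 0) +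
      (if 0 < -1 * ori a b v then 1 else 0) + (if 0 < -1 * ori b c v then 1 else 0) +
      (if 0 < -1 * ori c a v then 1 else 0)) := by
    apply Finset.sum_le_sum
    intro v hv
    rw [hV] at hv
    have n1 := ori_ne_v hgp ha hb hab hv
    have n2 := ori_ne_v hgp hb hc hbc hv
    have n3 := ori_ne_v hgp hc ha hac.symm hv
    rcases lt_or_gt_of_ne n1 with m1 | m1 <;> rcases lt_or_gt_of_ne n2 with m2 | m2 <;>
    rcases lt_or_gt_of_ne n3 with m3 | m3 <;>
      simp [m1, m2, m3, m1.not_gt, m2.not_gt, m3.not_gt]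
  simp only [Finset.sum_add_distrib, Finset.sum_const, smul_eq_mul] at key
  omega

lemma two_case {Z : Set Pt} (hgp : GenPos Z) (hno : ¬ HasHole 6 Z) {V : Finset Pt}
    (hV : ∀ p, p ∈ V ↔ p ∈ hullVertices Z) (h8 : 8 ≤ V.card)
    {a b : Pt} (ha : Inn Z a) (hb : Inn Z b) (hab : a ≠ b)
    (h : ∀ s, Inn Z s → s = a ∨ s = b) : False := by
  have e1 := edge_le hno hV ha hb hab (-1) (by
    intro s hs k1 k2
    have := h s hs
    tauto)
  have e2 := edge_le hno hV ha hb hab 1 (by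
    intro s hs k1 k2
    have := h s hs
    tauto)
  simp only [Finset.card_filter] at e1 e2
  have key : ∑ v ∈ V, 1 ≤ ∑ v ∈ V, ((if 0 < -1 * ori a b v then 1 else 0) +
      (if 0 < 1 * ori a b v then 1 else 0)) := by
    apply Finset.sum_le_sum
    intro v hv
    rw [hV] at hv
    have n1 := ori_ne_v hgp ha hb hab hv
    rcases lt_or_gt_of_ne n1 with m1 | m1 <;> simp [m1, m1.not_gt]
  simp only [Finset.sum_add_distrib, Finset.sum_const, smul_eq_mul] at key
  omega

lemma zero_case {Z : Set Pt} (hno : ¬ HasHole 6 Z) {V : Finset Pt}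
    (hV : ∀ p, p ∈ V ↔ p ∈ hullVertices Z) (h8 : 8 ≤ V.card)
    (h : ∀ s, ¬ Inn Z s) : False := by
  obtain ⟨T, hTs, hT⟩ := Finset.exists_subset_card_eq (show 6 ≤ V.card by omega)
  apply hno
  refine mk_hole ∅ T (by simp) (fun v hv => (hV v).1 (hTs hv)) (by simp [hT]) (by simp) ?_
  intro s hs hsV
  exact absurd ⟨hs, hsV⟩ (h s)

lemma one_case {Z : Set Pt} (hgp : GenPos Z) (hno : ¬ HasHole 6 Z) {V : Finset Pt}
    (hV : ∀ p, p ∈ V ↔ p ∈ hullVertices Z) (h8 : 8 ≤ V.card)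
    {a : Pt} (ha : Inn Z a) (h : ∀ s, Inn Z s → s = a) : False := by
  obtain ⟨u, hu⟩ := Finset.card_pos.mp (show 0 < V.card by omega)
  have huV := (hV u).1 hu
  have hau : a ≠ u := by rintro rfl; exact ha.2 huV
  have main : ∀ σ : ℝ, ((V.erase u).filter fun v => 0 < σ * ori a u v).card ≤ 3 := by
    intro σ
    by_contra hcon
    push Not at hcon
    obtain ⟨T, hTs, hT⟩ := Finset.exists_subset_card_eq (Nat.succ_le_of_lt hcon)
    have hT' : ∀ v ∈ T, (v ≠ u ∧ v ∈ hullVertices Z) ∧ 0 < σ * ori a u v := by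
      intro v hv
      have := hTs hv
      rwa [Finset.mem_filter, Finset.mem_erase, hV] at this
    apply hno
    refine mk_hole {a} (insert u T) ?_ ?_ ?_ ?_ ?_
    · simp only [Finset.mem_singleton]
      rintro p rfl; exact ha
    · simp only [Finset.mem_insert]
      rintro p (rfl | hp)
      · exact huV
      · exact (hT' p hp).1.2
    · rw [Finset.card_insert_of_notMem (fun hh => (hT' u hh).1.1 rfl), hT]; rfl
    · simp only [Finset.mem_singleton, Finset.mem_union, Finset.mem_insert]
      rintro p rfl
      refine ⟨u, by simp, hau.symm, σ, ?_⟩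
      rintro r (rfl | rfl | hr) k1 k2
      · exact absurd rfl k1
      · exact absurd rfl k2
      · exact (hT' r hr).2
    · intro s hs hsV hsA
      exact absurd (by simpa using h s ⟨hs, hsV⟩) hsA
  have e1 := main 1
  have e2 := main (-1)
  have hcard := Finset.card_erase_of_mem hu
  simp only [Finset.card_filter] at e1 e2
  have key : ∑ v ∈ V.erase u, 1 ≤ ∑ v ∈ V.erase u, ((if 0 < 1 * ori a u v then 1 else 0) +
      (if 0 < -1 * ori a u v then 1 else 0)) := by
    apply Finset.sum_le_sum
    intro v hv
    rw [Finset.mem_erase, hV] at hv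
    have n1 : ori a u v ≠ 0 := ori_ne hgp ha.1 huV.1 hv.2.1 hau
      (by rintro rfl; exact ha.2 hv.2) hv.1.symm
    rcases lt_or_gt_of_ne n1 with m1 | m1 <;> simp [m1, m1.not_gt]
  simp only [Finset.sum_add_distrib, Finset.sum_const, smul_eq_mul] at key
  omega

lemma four_case {Z : Set Pt} (hgp : GenPos Z) (hno : ¬ HasHole 6 Z) {V : Finset Pt}
    (hV : ∀ p, p ∈ V ↔ p ∈ hullVertices Z) (h8 : 8 ≤ V.card)
    {a b c d : Pt} (ha : Inn Z a) (hb : Inn Z b)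
    (hc : Inn Z c) (hd : Inn Z d) (hab : a ≠ b) (hac : a ≠ c) (had : a ≠ d) (hbc : b ≠ c)
    (hbd : b ≠ d) (hcd : c ≠ d) (h : ∀ s, Inn Z s → s = a ∨ s = b ∨ s = c ∨ s = d) : False := by
  -- after exchanging `a` and `b` the triple `a b c` is positively oriented
  wlog h0 : 0 < ori a b c generalizing a b
  · refine this hb ha hab.symm hbc hbd hac had (by intro s hs; have := h s hs; tauto) ?_
    have := ori_ne hgp ha.1 hb.1 hc.1 hab hac hbc
    have h' := lt_of_le_of_ne (not_lt.mp h0) this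
    unfold ori at *; linarith
  have n1 := ori_ne hgp ha.1 hb.1 hd.1 hab had hbd
  have n2 := ori_ne hgp hb.1 hc.1 hd.1 hbc hbd hcd
  have n3 := ori_ne hgp hc.1 ha.1 hd.1 hac.symm hcd had
  have hba := hab.symm
  have hca := hac.symm
  have hda := had.symm
  have hcb := hbc.symm
  have hdb := hbd.symm
  have hdc := hcd.symm
  rcases lt_or_gt_of_ne n1 with m1 | m1 <;> rcases lt_or_gt_of_ne n2 with m2 | m2 <;>
    rcases lt_or_gt_of_ne n3 with m3 | m3
  · unfold ori at *; linarith
  · -- beyond `ab` and `bc`: `b` lies in the triangle `a d c`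
    refine star_case hgp hno hV h8 ha hd hc hb had hac hab hdc hdb hcb
      (by intro s hs; have := h s hs; tauto) ?_ ?_ ?_ <;> (unfold ori at *; linarith)
  · -- beyond `ab` and `ca`: `a` lies in the triangle `d b c`
    refine star_case hgp hno hV h8 hd hb hc ha hdb hdc hda hbc hba hca
      (by intro s hs; have := h s hs; tauto) ?_ ?_ ?_ <;> (unfold ori at *; linarith)
  · -- beyond `ab` only
    refine quad_case hgp hno hV h8 ha hd hb hc had hab hac hdb hdc hbc
      (by intro s hs; have := h s hs; tauto) ?_ ?_ ?_ ?_ <;> (unfold ori at *; linarith)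
  · -- beyond `bc` and `ca`: `c` lies in the triangle `a b d`
    refine star_case hgp hno hV h8 ha hb hd hc hab had hac hbd hbc hdc
      (by intro s hs; have := h s hs; tauto) ?_ ?_ ?_ <;> (unfold ori at *; linarith)
  · -- beyond `bc` only
    refine quad_case hgp hno hV h8 ha hb hd hc hab had hac hbd hbc hdc
      (by intro s hs; have := h s hs; tauto) ?_ ?_ ?_ ?_ <;> (unfold ori at *; linarith)
  · -- beyond `ca` only
    refine quad_case hgp hno hV h8 ha hb hc hd hab hac had hbc hbd hcd
      (by intro s hs; have := h s hs; tauto) ?_ ?_ ?_ ?_ <;> (unfold ori at *; linarith)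
  · refine star_case hgp hno hV h8 ha hb hc hd hab hac had hbc hbd hcd
      (by intro s hs; have := h s hs; tauto) ?_ ?_ ?_ <;> (unfold ori at *; linarith)

/-- a set in general position with at least 8 convex hull vertices and
at most 4 interior points contains a 6-hole. -/
theorem statement_12 (Z : Set Pt) (hfin : Z.Finite) (hgp : GenPos Z)
    (hhull : 8 ≤ (hullVertices Z).ncard) (hint : (interiorPts Z).ncard ≤ 4) :
    HasHole 6 Z := by
  by_contra hno
  have hVfin : (hullVertices Z).Finite := hfin.subset (fun x hx => hx.1)
  have hIfin : {p | Inn Z p}.Finite := hfin.subset (fun x hx => hx.1)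
  have hV : ∀ p, p ∈ hVfin.toFinset ↔ p ∈ hullVertices Z := fun p => hVfin.mem_toFinset
  have hI : ∀ p, p ∈ hIfin.toFinset ↔ Inn Z p := fun p => hIfin.mem_toFinset
  have h8 : 8 ≤ hVfin.toFinset.card := by rwa [← Set.ncard_eq_toFinset_card _ hVfin]
  have h4 : hIfin.toFinset.card ≤ 4 := by
    rw [← Set.ncard_eq_toFinset_card _ hIfin]
    refine le_trans (Set.ncard_le_ncard ?_ (hfin.subset (fun x hx => hx.1))) hint
    intro p hp
    refine ⟨hp.1, mem_interior_of hgp hp.1 ?_⟩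
    by_contra hcon
    exact hp.2 ⟨hp.1, hcon⟩
  generalize hIfin.toFinset = I at hI h4
  obtain ⟨n, hn⟩ : ∃ n, I.card = n := ⟨_, rfl⟩
  rw [hn] at h4
  interval_cases n
  · rw [Finset.card_eq_zero] at hn
    subst hn
    exact zero_case hno hV h8 (fun s hs => by simpa using (hI s).2 hs)
  · obtain ⟨a, rfl⟩ := Finset.card_eq_one.mp hn
    exact one_case hgp hno hV h8 ((hI a).1 (by simp)) (fun s hs => by simpa using (hI s).2 hs)
  · obtain ⟨a, b, hab, rfl⟩ := Finset.card_eq_two.mp hn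
    exact two_case hgp hno hV h8 ((hI a).1 (by simp)) ((hI b).1 (by simp)) hab
      (fun s hs => by simpa using (hI s).2 hs)
  · obtain ⟨a, b, c, hab, hac, hbc, rfl⟩ := Finset.card_eq_three.mp hn
    have ha := (hI a).1 (by simp)
    have hb := (hI b).1 (by simp)
    have hc := (hI c).1 (by simp)
    have h : ∀ s, Inn Z s → s = a ∨ s = b ∨ s = c := fun s hs => by simpa using (hI s).2 hs
    rcases lt_or_gt_of_ne (ori_ne hgp ha.1 hb.1 hc.1 hab hac hbc) with m | m
    · exact three_case hgp hno hV h8 hb ha hc hab.symm hbc hac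
        (by intro s hs; have := h s hs; tauto) (by unfold ori at *; linarith)
    · exact three_case hgp hno hV h8 ha hb hc hab hac hbc h m
  · obtain ⟨a, J, haJ, rfl, hJ⟩ := Finset.card_eq_succ.mp hn
    obtain ⟨b, c, d, hbc, hbd, hcd, rfl⟩ := Finset.card_eq_three.mp hJ
    simp only [Finset.mem_insert, Finset.mem_singleton, not_or] at haJ
    exact four_case hgp hno hV h8 ((hI a).1 (by simp)) ((hI b).1 (by simp)) ((hI c).1 (by simp))
      ((hI d).1 (by simp)) haJ.1 haJ.2.1 haJ.2.2 hbc hbd hcd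
      (fun s hs => by simpa using (hI s).2 hs)
end
end

section
/- Let k ≥ 3 and ℓ ≥ 0 be integers with ℓ < k/2. Then there exists an ℓ-convex set of (k − 3)(ℓ + 1) + 2 points in the plane in general position that contains no k points in convex position. -/
open Set

noncomputable section

lemma ori_cyc (p q r : Pt) : ori q r p = ori p q r := by unfold ori; ring

lemma ori_swap (p q r : Pt) : ori q p r = - ori p q r := by unfold ori; ring

lemma ori_self1 (p q : Pt) : ori p p q = 0 := by unfold ori; ring

lemma ori_self2 (p q : Pt) : ori p q q = 0 := by unfold ori; ring

lemma ori_self3 (p q : Pt) : ori p q p = 0 := by unfold ori; ring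

/-- Clustered configuration: sign conditions on orientations. -/
structure Cfg (N L : ℕ) (T : ℕ → Prop) (P : ℕ → ℕ → Pt) : Prop where
  A : ∀ i j m s t u, i < j → j < m → m ≤ N → s ≤ L → t ≤ L → u ≤ L →
    0 < ori (P i s) (P j t) (P m u)
  B : ∀ i m s t u, i < m → m ≤ N → s < t → t ≤ L → u ≤ L →
    ori (P i s) (P i t) (P m u) < 0
  B' : ∀ i m s t u, m < i → i ≤ N → s < t → t ≤ L → u ≤ L →
    0 < ori (P i s) (P i t) (P m u)
  C : ∀ i s t u, i ≤ N → s < t → t < u → u ≤ L → T i →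
    0 < ori (P i s) (P i t) (P i u)
  C' : ∀ i s t u, i ≤ N → s < t → t < u → u ≤ L → ¬ T i →
    ori (P i s) (P i t) (P i u) < 0
  D : ∀ i j s t, i < j → j ≤ N → s ≤ L → t ≤ L → (P i s).1 < (P j t).1
  E : ∀ i s t, s < t → t ≤ L → P i s ≠ P i t

lemma mem_hull_of_ori (p a b c : Pt) (h1 : 0 < ori p a b) (h2 : 0 < ori p b c)
    (h3 : 0 < ori p c a) : p ∈ convexHull ℝ ({a, b, c} : Set Pt) := by
  have hs : 0 < ori p a b + ori p b c + ori p c a := by positivity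
  have hc : Convex ℝ (convexHull ℝ ({a, b, c} : Set Pt)) := convex_convexHull ℝ _
  have ha : a ∈ convexHull ℝ ({a, b, c} : Set Pt) := subset_convexHull ℝ _ (by simp)
  have hb : b ∈ convexHull ℝ ({a, b, c} : Set Pt) := subset_convexHull ℝ _ (by simp)
  have hcc : c ∈ convexHull ℝ ({a, b, c} : Set Pt) := subset_convexHull ℝ _ (by simp)
  have key := hc.sum_mem (t := Finset.univ)
    (w := ![ori p b c / (ori p a b + ori p b c + ori p c a),
      ori p c a / (ori p a b + ori p b c + ori p c a),
      ori p a b / (ori p a b + ori p b c + ori p c a)]) (z := ![a, b, c])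
    (by intro i _; fin_cases i <;> simp <;> positivity)
    (by simp [Fin.sum_univ_three]; field_simp; ring)
    (by intro i _; fin_cases i <;> simp [ha, hb, hcc])
  convert key using 1
  simp only [Fin.sum_univ_three, Matrix.cons_val_zero, Matrix.cons_val_one, Matrix.cons_val]
  ext
  · simp only [Prod.fst_add, Prod.smul_fst, smul_eq_mul]
    field_simp
    unfold ori; ring
  · simp only [Prod.snd_add, Prod.smul_snd, smul_eq_mul]
    field_simp
    unfold ori; ring

lemma convexPos_contra (H : Set Pt) (hH : ConvexPos H) (p a b c : Pt) (hp : p ∈ H)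
    (ha : a ∈ H) (hb : b ∈ H) (hc : c ∈ H) (h1 : 0 < ori p a b) (h2 : 0 < ori p b c)
    (h3 : 0 < ori p c a) : False := by
  refine hH p hp (convexHull_mono ?_ (mem_hull_of_ori p a b c h1 h2 h3))
  have e1 : a ≠ p := by rintro rfl; rw [ori_self1] at h1; exact lt_irrefl _ h1
  have e2 : b ≠ p := by rintro rfl; rw [ori_self1] at h2; exact lt_irrefl _ h2
  have e3 : c ≠ p := by rintro rfl; rw [ori_self1] at h3; exact lt_irrefl _ h3
  intro x hx
  simp only [mem_insert_iff, mem_singleton_iff] at hx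
  rcases hx with rfl | rfl | rfl
  · exact ⟨ha, e1⟩
  · exact ⟨hb, e2⟩
  · exact ⟨hc, e3⟩

lemma not_interior (u v : ℝ) (huv : u ≠ 0 ∨ v ≠ 0) (q : Pt) (K : Set Pt)
    (h : ∀ p ∈ K, u * q.1 + v * q.2 ≤ u * p.1 + v * p.2) :
    q ∉ interior (convexHull ℝ K) := by
  intro hq
  have hsub : convexHull ℝ K ⊆ {p : Pt | u * q.1 + v * q.2 ≤ u * p.1 + v * p.2} := by
    refine convexHull_min h ?_
    intro x hx y hy a b ha hb hab
    simp only [mem_ofPred_eq, Prod.fst_add, Prod.snd_add, Prod.smul_fst, Prod.smul_snd,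
      smul_eq_mul] at *
    have : u * q.1 + v * q.2 = a * (u * q.1 + v * q.2) + b * (u * q.1 + v * q.2) := by
      rw [← add_mul, hab, one_mul]
    rw [this]
    nlinarith [mul_le_mul_of_nonneg_left hx ha, mul_le_mul_of_nonneg_left hy hb]
  have hcont : Continuous (fun t : ℝ => ((q.1 - t * u, q.2 - t * v) : Pt)) := by fun_prop
  have hopen : IsOpen ((fun t : ℝ => ((q.1 - t * u, q.2 - t * v) : Pt)) ⁻¹'
      interior (convexHull ℝ K)) := isOpen_interior.preimage hcont
  have h0 : (0 : ℝ) ∈ (fun t : ℝ => ((q.1 - t * u, q.2 - t * v) : Pt)) ⁻¹'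
      interior (convexHull ℝ K) := by simpa using hq
  obtain ⟨e, he, hball⟩ := Metric.isOpen_iff.1 hopen 0 h0
  have hm : (e / 2) ∈ Metric.ball (0 : ℝ) e := by
    rw [Metric.mem_ball, Real.dist_eq, sub_zero, abs_of_pos (by positivity)]; linarith
  have := hsub (interior_subset (hball hm))
  simp only [mem_ofPred_eq] at this
  have hpos : 0 < u ^ 2 + v ^ 2 := by
    rcases huv with h | h <;> positivity
  nlinarith [mul_pos he hpos]

lemma interior_ne (q a b c : Pt) (h : q ∈ interior (convexHull ℝ ({a, b, c} : Set Pt))) :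
    q ≠ a := by
  rintro rfl
  by_cases hb : q = b
  · subst hb
    by_cases hc : q = c
    · subst hc
      refine not_interior 1 0 (by simp) q _ ?_ h
      simp
    · refine not_interior (c.1 - q.1) (c.2 - q.2) ?_ q _ ?_ h
      · by_contra hcon
        push Not at hcon
        exact hc (Prod.ext (by linarith [hcon.1]) (by linarith [hcon.2]))
      · intro p hp
        simp only [mem_insert_iff, mem_singleton_iff] at hp
        rcases hp with rfl | rfl | rfl
        · exact le_rfl
        · exact le_rfl
        · nlinarith [sq_nonneg (p.1 - q.1), sq_nonneg (p.2 - q.2)]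
  · have hne : ¬ (b.1 - q.1 = 0 ∧ b.2 - q.2 = 0) := by
      rintro ⟨h1, h2⟩
      exact hb (Prod.ext (by linarith) (by linarith))
    rcases le_total 0 (ori q b c) with hs | hs
    · refine not_interior (-(b.2 - q.2)) (b.1 - q.1) ?_ q _ ?_ h
      · by_contra hcon
        push Not at hcon
        exact hne ⟨hcon.2, by linarith [hcon.1]⟩
      · intro p hp
        unfold ori at hs
        simp only [mem_insert_iff, mem_singleton_iff] at hp
        rcases hp with rfl | rfl | rfl <;> nlinarith
    · refine not_interior (b.2 - q.2) (-(b.1 - q.1)) ?_ q _ ?_ h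
      · by_contra hcon
        push Not at hcon
        exact hne ⟨by linarith [hcon.2], hcon.1⟩
      · intro p hp
        unfold ori at hs
        simp only [mem_insert_iff, mem_singleton_iff] at hp
        rcases hp with rfl | rfl | rfl <;> nlinarith

lemma interior_ori (q a b c : Pt) (h : q ∈ interior (convexHull ℝ ({a, b, c} : Set Pt))) :
    ¬ (0 < ori q a b ∧ 0 < ori q a c) ∧ ¬ (ori q a b < 0 ∧ ori q a c < 0) := by
  have hne : ¬ (a.1 - q.1 = 0 ∧ a.2 - q.2 = 0) := by
    rintro ⟨h1, h2⟩
    exact interior_ne q a b c h (Prod.ext (by linarith) (by linarith))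
  constructor
  · rintro ⟨h1, h2⟩
    refine not_interior (-(a.2 - q.2)) (a.1 - q.1) ?_ q _ ?_ h
    · by_contra hcon
      push Not at hcon
      exact hne ⟨hcon.2, by linarith [hcon.1]⟩
    · intro p hp
      unfold ori at h1 h2
      simp only [mem_insert_iff, mem_singleton_iff] at hp
      rcases hp with rfl | rfl | rfl <;> nlinarith
  · rintro ⟨h1, h2⟩
    refine not_interior (a.2 - q.2) (-(a.1 - q.1)) ?_ q _ ?_ h
    · by_contra hcon
      push Not at hcon
      exact hne ⟨by linarith [hcon.2], hcon.1⟩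
    · intro p hp
      unfold ori at h1 h2
      simp only [mem_insert_iff, mem_singleton_iff] at hp
      rcases hp with rfl | rfl | rfl <;> nlinarith

lemma ori_of_collinear (p q r : Pt) (h : Collinear ℝ ({p, q, r} : Set Pt)) :
    ori p q r = 0 := by
  rw [collinear_iff_of_mem (p₀ := p) (by simp)] at h
  obtain ⟨v, hv⟩ := h
  obtain ⟨a, ha⟩ := hv q (by simp)
  obtain ⟨b, hb⟩ := hv r (by simp)
  rw [ha, hb]
  simp only [ori, vadd_eq_add, Prod.fst_add, Prod.snd_add, Prod.smul_fst, Prod.smul_snd,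
      smul_eq_mul]
  ring

section cfg
variable {N L : ℕ} {T : ℕ → Prop} {P : ℕ → ℕ → Pt}

/-- interior points lie in the median cluster -/
lemma Cfg.median (h : Cfg N L T P) (c i j m r s t u : ℕ) (hij : i ≤ j) (hjm : j ≤ m)
    (hm : m ≤ N) (hc : c ≤ N) (hr : r ≤ L) (hs : s ≤ L) (ht : t ≤ L) (hu : u ≤ L)
    (hq : P c r ∈ interior (convexHull ℝ ({P i s, P j t, P m u} : Set Pt))) : c = j := by
  by_contra hcj
  rcases lt_or_gt_of_ne hcj with hlt | hgt
  · have hne := interior_ne _ _ _ _ hq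
    have ho := interior_ori _ _ _ _ hq
    rcases lt_trichotomy c i with hci | hci | hci
    · refine not_interior 1 0 (by simp) _ _ ?_ hq
      intro p hp
      simp only [mem_insert_iff, mem_singleton_iff] at hp
      rcases hp with rfl | rfl | rfl
      · linarith [h.D c i r s hci (by omega) hr hs]
      · linarith [h.D c j r t hlt (by omega) hr ht]
      · linarith [h.D c m r u (by omega) hm hr hu]
    · subst hci
      rcases lt_trichotomy r s with hrs | hrs | hrs
      · exact ho.2 ⟨h.B _ _ _ _ _ hlt (by omega) hrs hs ht,
          h.B _ _ _ _ _ (by omega) (by omega) hrs hs hu⟩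
      · subst hrs; exact hne rfl
      · rw [ori_swap, ori_swap _ _ (P m u)] at ho
        have h1 := h.B c j s r t hlt (by omega) hrs hr ht
        have h2 := h.B c m s r u (by omega) (by omega) hrs hr hu
        exact ho.1 ⟨by linarith, by linarith⟩
    · rw [ori_swap, ori_swap _ _ (P m u)] at ho
      have h1 := h.A i c j s r t hci hlt (by omega) hs hr ht
      have h2 := h.A i c m s r u hci (by omega) (by omega) hs hr hu
      exact ho.2 ⟨by linarith, by linarith⟩
  · rw [show ({P i s, P j t, P m u} : Set Pt) = {P m u, P i s, P j t} by
      ext; simp only [mem_insert_iff, mem_singleton_iff]; tauto] at hq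
    have hne := interior_ne _ _ _ _ hq
    have ho := interior_ori _ _ _ _ hq
    rcases lt_trichotomy c m with hci | hci | hci
    · have h1 := h.A i c m s r u (by omega) hci (by omega) hs hr hu
      have h2 := h.A j c m t r u hgt (by omega) (by omega) ht hr hu
      rw [← ori_cyc] at h1 h2
      exact ho.1 ⟨h1, h2⟩
    · subst hci
      rcases lt_trichotomy r u with hrs | hrs | hrs
      · exact ho.1 ⟨h.B' _ _ _ _ _ (by omega) (by omega) hrs hu hs,
          h.B' _ _ _ _ _ (by omega) (by omega) hrs hu ht⟩
      · subst hrs; exact hne rfl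
      · rw [ori_swap, ori_swap _ _ (P j t)] at ho
        have h1 := h.B' c i u r s (by omega) (by omega) hrs hr hs
        have h2 := h.B' c j u r t (by omega) (by omega) hrs hr ht
        exact ho.2 ⟨by linarith, by linarith⟩
    · refine not_interior (-1) 0 (by simp) _ _ ?_ hq
      intro p hp
      simp only [mem_insert_iff, mem_singleton_iff] at hp
      rcases hp with rfl | rfl | rfl
      · linarith [h.D m c u r hci (by omega) hu hr]
      · linarith [h.D i c s r (by omega) (by omega) hs hr]
      · linarith [h.D j c t r (by omega) (by omega) ht hr]

lemma Cfg.inj (h : Cfg N L T P) (i j s t : ℕ) (hi : i ≤ N) (hj : j ≤ N) (hs : s ≤ L)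
    (ht : t ≤ L) (he : P i s = P j t) : i = j ∧ s = t := by
  have hij : i = j := by
    by_contra hne
    rcases lt_or_gt_of_ne hne with hl | hl
    · have := h.D i j s t hl hj hs ht
      rw [he] at this; exact lt_irrefl _ this
    · have := h.D j i t s hl hi ht hs
      rw [he] at this; exact lt_irrefl _ this
  subst hij
  refine ⟨rfl, ?_⟩
  by_contra hne
  rcases lt_or_gt_of_ne hne with hl | hl
  · exact h.E i s t hl ht he
  · exact h.E i t s hl hs he.symm

/-- lexicographic comparison -/
def lexlt (a b : ℕ × ℕ) : Prop := a.1 < b.1 ∨ (a.1 = b.1 ∧ a.2 < b.2)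

lemma lexlt_total (a b : ℕ × ℕ) (h : a ≠ b) : lexlt a b ∨ lexlt b a := by
  have : ¬ (a.1 = b.1 ∧ a.2 = b.2) := fun hh => h (Prod.ext hh.1 hh.2)
  unfold lexlt; omega

lemma Cfg.sorted_ne (h : Cfg N L T P) (a b c : ℕ × ℕ) (hab : lexlt a b) (hbc : lexlt b c)
    (hc1 : c.1 ≤ N) (ha : a.2 ≤ L) (hb : b.2 ≤ L) (hc : c.2 ≤ L) :
    ori (P a.1 a.2) (P b.1 b.2) (P c.1 c.2) ≠ 0 := by
  obtain ⟨i, s⟩ := a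
  obtain ⟨j, t⟩ := b
  obtain ⟨m, u⟩ := c
  simp only [lexlt] at *
  rcases hab with hab | ⟨rfl, hab⟩ <;> rcases hbc with hbc | ⟨rfl, hbc⟩
  · exact (h.A i j m s t u hab hbc hc1 ha hb hc).ne'
  · rw [← ori_cyc]
    exact (h.B' j i t u s hab hc1 hbc hc ha).ne'
  · exact (h.B i m s t u hbc hc1 hab hb hc).ne
  · by_cases hT : T i
    · exact (h.C i s t u hc1 hab hbc hc hT).ne'
    · exact (h.C' i s t u hc1 hab hbc hc hT).ne

lemma Cfg.ori_ne (h : Cfg N L T P) (a b c : ℕ × ℕ) (hab : a ≠ b) (hbc : b ≠ c) (hac : a ≠ c)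
    (ha1 : a.1 ≤ N) (hb1 : b.1 ≤ N)
    (hc1 : c.1 ≤ N) (ha : a.2 ≤ L) (hb : b.2 ≤ L) (hc : c.2 ≤ L) :
    ori (P a.1 a.2) (P b.1 b.2) (P c.1 c.2) ≠ 0 := by
  intro h0
  have e1 := ori_cyc (P a.1 a.2) (P b.1 b.2) (P c.1 c.2)
  have e2 := ori_cyc (P b.1 b.2) (P c.1 c.2) (P a.1 a.2)
  have e3 := ori_swap (P a.1 a.2) (P b.1 b.2) (P c.1 c.2)
  have e4 := ori_swap (P b.1 b.2) (P c.1 c.2) (P a.1 a.2)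
  have e5 := ori_swap (P c.1 c.2) (P a.1 a.2) (P b.1 b.2)
  rcases lexlt_total a b hab with h1 | h1 <;> rcases lexlt_total b c hbc with h2 | h2 <;>
    rcases lexlt_total a c hac with h3 | h3
  · exact h.sorted_ne a b c h1 h2 hc1 ha hb hc h0
  · exact h.sorted_ne a b c h1 h2 hc1 ha hb hc h0
  · exact h.sorted_ne a c b h3 h2 hb1 ha hc hb (by linarith)
  · exact h.sorted_ne c a b h3 h1 hb1 hc ha hb (by linarith)
  · exact h.sorted_ne b a c h1 h3 hc1 hb ha hc (by linarith)
  · exact h.sorted_ne b c a h2 h3 ha1 hb hc ha (by linarith)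
  · exact h.sorted_ne c b a h2 h1 ha1 hc hb ha (by linarith)
  · exact h.sorted_ne c b a h2 h1 ha1 hc hb ha (by linarith)

/-- two points in a cluster: the rest on one side -/
lemma Cfg.two (h : Cfg N L T P) (H : Set Pt) (hH : ConvexPos H) (m i n r s t u : ℕ)
    (hmi : m < i) (hin : i < n) (hn : n ≤ N) (hst : s < t) (hr : r ≤ L) (ht : t ≤ L) (hu : u ≤ L)
    (h1 : P m r ∈ H) (h2 : P i s ∈ H) (h3 : P i t ∈ H) (h4 : P n u ∈ H) : False := by
  refine convexPos_contra H hH (P i t) (P m r) (P i s) (P n u) h3 h1 h2 h4 ?_ ?_ ?_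
  · have := h.B' i m s t r hmi (by omega) hst ht hr
    rwa [← ori_cyc] at this
  · have := h.B i n s t u hin (by omega) hst ht hu
    rw [ori_swap]; linarith
  · have := h.A m i n r t u hmi hin hn hr ht hu
    rwa [← ori_cyc] at this

lemma Cfg.three (h : Cfg N L T P) (H : Set Pt) (hH : ConvexPos H) (i n s t v u : ℕ)
    (hin : i < n) (hn : n ≤ N) (hst : s < t) (htv : t < v) (hv : v ≤ L) (hu : u ≤ L) (hT : T i)
    (h2 : P i s ∈ H) (h3 : P i t ∈ H) (h5 : P i v ∈ H) (h4 : P n u ∈ H) : False := by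
  refine convexPos_contra H hH (P i t) (P i s) (P n u) (P i v) h3 h2 h4 h5 ?_ ?_ ?_
  · have := h.B i n s t u hin (by omega) hst (by omega) hu
    rw [ori_swap]; linarith
  · have := h.B i n t v u hin (by omega) htv (by omega) hu
    have e : ori (P i t) (P n u) (P i v) = - ori (P i t) (P i v) (P n u) := by
      unfold ori; ring
    rw [e]; linarith
  · have := h.C i s t v (by omega) hst htv hv hT
    rwa [← ori_cyc] at this

lemma Cfg.three' (h : Cfg N L T P) (H : Set Pt) (hH : ConvexPos H) (i n s t v u : ℕ)
    (hin : n < i) (hn : i ≤ N) (hst : s < t) (htv : t < v) (hv : v ≤ L) (hu : u ≤ L) (hT : ¬ T i)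
    (h2 : P i s ∈ H) (h3 : P i t ∈ H) (h5 : P i v ∈ H) (h4 : P n u ∈ H) : False := by
  refine convexPos_contra H hH (P i t) (P i v) (P n u) (P i s) h3 h5 h4 h2 ?_ ?_ ?_
  · exact h.B' i n t v u hin (by omega) htv (by omega) hu
  · have := h.B' i n s t u hin (by omega) hst (by omega) hu
    rwa [← ori_cyc] at this
  · have := h.C' i s t v (by omega) hst htv hv hT
    rw [ori_swap]; linarith

end cfg

lemma ori_par (e x y z s t u : ℝ) :
    ori (x, x ^ 2 + e * s) (y, y ^ 2 + e * t) (z, z ^ 2 + e * u) =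
      (y - x) * (z - x) * (z - y) + e * (s * (z - y) - t * (z - x) + u * (y - x)) := by
  unfold ori; ring

lemma par_B (e M L x y z s t u : ℝ) (he : 0 < e) (hM : 0 < M) (hL : 0 ≤ L)
    (h1 : |y - x| * M ≤ e / 4) (h2 : |y - x| * L ≤ 1 / 8) (hz : 1 / 2 ≤ z - x)
    (hz' : z - y ≤ M) (hzy : 0 ≤ z - y) (hst : s + 1 ≤ t) (hu : |u - s| ≤ L) :
    (y - x) * (z - x) * (z - y) + e * (s * (z - y) - t * (z - x) + u * (y - x)) < 0 := by
  have e1 : (y - x) * (z - x) * (z - y) + e * (s * (z - y) - t * (z - x) + u * (y - x))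
      = (z - x) * ((y - x) * (z - y)) - e * (t - s) * (z - x) + e * ((y - x) * (u - s)) := by
    ring
  have e2 : (y - x) * (z - y) ≤ e / 4 :=
    calc (y - x) * (z - y) ≤ |y - x| * (z - y) := by gcongr; exact le_abs_self _
      _ ≤ |y - x| * M := by gcongr
      _ ≤ _ := h1
  have e3 : (y - x) * (u - s) ≤ 1 / 8 :=
    calc (y - x) * (u - s) ≤ |(y - x) * (u - s)| := le_abs_self _
      _ = |y - x| * |u - s| := abs_mul _ _
      _ ≤ |y - x| * L := by gcongr
      _ ≤ _ := h2
  have e4 : (z - x) * ((y - x) * (z - y)) ≤ (z - x) * (e / 4) :=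
    mul_le_mul_of_nonneg_left e2 (by linarith)
  have e5 : e * ((y - x) * (u - s)) ≤ e * (1 / 8) := mul_le_mul_of_nonneg_left e3 he.le
  have e6 : e * (z - x) ≤ e * (t - s) * (z - x) := by
    have : 0 ≤ e * (z - x) := mul_nonneg he.le (by linarith)
    nlinarith
  rw [e1]
  nlinarith [mul_le_mul_of_nonneg_left hz he.le]

lemma par_C (e d s t u : ℝ) (K : ℝ) (hd : 0 < d) (hK : d ^ 2 * K < e) (hst : s < t)
    (htu : t < u) (hs : 0 ≤ s) (hb : (t + s) * (u + s) * (u + t) ≤ K) :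
    0 < d * (t - s) * (u - s) * (u - t) * (e - d ^ 2 * ((t + s) * (u + s) * (u + t))) := by
  have h1 : 0 < t - s := by linarith
  have h2 : 0 < u - s := by linarith
  have h3 : 0 < u - t := by linarith
  have h4 : 0 < e - d ^ 2 * ((t + s) * (u + s) * (u + t)) := by
    nlinarith [mul_le_mul_of_nonneg_left hb (sq_nonneg d)]
  positivity

set_option maxHeartbeats 2000000 in
lemma exists_cfg (N L : ℕ) (T : ℕ → Prop) : ∃ P, Cfg N L T P := by
  classical
  obtain ⟨e, he⟩ : ∃ e : ℝ, e = 1 / (8 * (L + 1)) := ⟨_, rfl⟩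
  obtain ⟨d, hd⟩ : ∃ d : ℝ, d = e / (8 * (N + 1) * (L + 1) ^ 3) := ⟨_, rfl⟩
  have hL : (0 : ℝ) ≤ L := Nat.cast_nonneg L
  have hN : (0 : ℝ) ≤ N := Nat.cast_nonneg N
  have he0 : 0 < e := by rw [he]; positivity
  have hd0 : 0 < d := by rw [hd]; positivity
  have heL : e * (8 * (L + 1)) = 1 := by rw [he]; field_simp
  have he1 : e ≤ 1 / 8 := by nlinarith
  have hdN : d * (8 * (N + 1) * (L + 1) ^ 3) = e := by rw [hd]; field_simp
  have hdL3 : d * (8 * (L + 1) ^ 3) ≤ e := by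
    have : 0 ≤ d * (8 * (L + 1) ^ 3) * N := by positivity
    nlinarith
  have hdL2 : d * (L ^ 2 * (8 * (N + 1))) ≤ e := by
    rw [← hdN]
    have : (L : ℝ) ^ 2 ≤ (L + 1) ^ 3 := by nlinarith [pow_nonneg hL 3]
    have h2 : (L : ℝ) ^ 2 * (8 * (N + 1)) ≤ (L + 1) ^ 3 * (8 * (N + 1)) := by gcongr
    nlinarith [mul_le_mul_of_nonneg_left h2 hd0.le]
  have hdd : d * L ^ 2 * 8 ≤ e := by
    have : 0 ≤ d * L ^ 2 * 8 * N := by positivity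
    nlinarith
  have hd1 : d ≤ 1 / 64 := by
    have : (1 : ℝ) ≤ (L + 1) ^ 3 := one_le_pow₀ (by linarith)
    nlinarith
  let sg : ℕ → ℝ := fun i => if T i then -1 else 1
  let X : ℕ → ℕ → ℝ := fun i s => i + sg i * d * s ^ 2
  have hsg : ∀ i, |sg i| = 1 := by
    intro i; simp only [sg]; split_ifs <;> simp
  have hsq : ∀ s : ℕ, s ≤ L → (s : ℝ) ^ 2 ≤ L ^ 2 := by
    intro s hs
    have : (s : ℝ) ≤ L := by exact_mod_cast hs
    gcongr
  have hX : ∀ i s, s ≤ L → |X i s - i| ≤ 1 / 64 := by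
    intro i s hs
    have : X i s - i = sg i * (d * s ^ 2) := by simp only [X]; ring
    rw [this, abs_mul, hsg, one_mul, abs_of_nonneg (by positivity)]
    nlinarith [mul_le_mul_of_nonneg_left (hsq s hs) hd0.le]
  have hgap : ∀ i j s t, i < j → s ≤ L → t ≤ L → 1 / 2 ≤ X j t - X i s := by
    intro i j s t hij hs ht
    have h1 := abs_le.1 (hX i s hs)
    have h2 := abs_le.1 (hX j t ht)
    have h3 : (i : ℝ) + 1 ≤ j := by exact_mod_cast hij
    linarith [h1.1, h1.2, h2.1, h2.2]
  have hup : ∀ i j s t, i < j → j ≤ N → s ≤ L → t ≤ L → X j t - X i s ≤ N + 1 := by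
    intro i j s t hij hj hs ht
    have h1 := abs_le.1 (hX i s hs)
    have h2 := abs_le.1 (hX j t ht)
    have h3 : (j : ℝ) ≤ N := by exact_mod_cast hj
    have h4 : (0 : ℝ) ≤ i := Nat.cast_nonneg i
    linarith [h1.1, h1.2, h2.1, h2.2]
  have hclose : ∀ i s t, s < t → t ≤ L → |X i t - X i s| ≤ d * L ^ 2 := by
    intro i s t hst ht
    have : X i t - X i s = sg i * (d * (t ^ 2 - s ^ 2)) := by simp only [X]; ring
    have h3 : (s : ℝ) ≤ t := by exact_mod_cast hst.le
    have h4 : (0 : ℝ) ≤ s := Nat.cast_nonneg s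
    have h5 : (0 : ℝ) ≤ (t : ℝ) ^ 2 - s ^ 2 := by nlinarith
    rw [this, abs_mul, hsg, one_mul, abs_of_nonneg (by positivity)]
    have := hsq t ht
    gcongr
    nlinarith
  have hdiff : ∀ s u : ℕ, s ≤ L → u ≤ L → |(u : ℝ) - s| ≤ L := by
    intro s u hs hu
    have h1 : (s : ℝ) ≤ L := by exact_mod_cast hs
    have h2 : (u : ℝ) ≤ L := by exact_mod_cast hu
    have h3 : (0 : ℝ) ≤ s := Nat.cast_nonneg s
    have h4 : (0 : ℝ) ≤ u := Nat.cast_nonneg u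
    rw [abs_le]; constructor <;> linarith
  have hdM : d * L ^ 2 * (N + 1) ≤ e / 4 := by nlinarith
  have hdL : d * (L : ℝ) ^ 2 * L ≤ 1 / 8 := by
    have h1 : (L : ℝ) ^ 3 ≤ (L + 1) ^ 3 := by gcongr; linarith
    nlinarith [mul_le_mul_of_nonneg_left h1 hd0.le]
  have hCC : ∀ i s t u : ℕ, s < t → t < u → u ≤ L →
      0 < d * ((t : ℝ) - s) * (u - s) * (u - t) *
        (e - d ^ 2 * (((t : ℝ) + s) * (u + s) * (u + t))) := by
    intro i s t u hst htu hu
    have h1 : (s : ℝ) < t := by exact_mod_cast hst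
    have h2 : (t : ℝ) < u := by exact_mod_cast htu
    have h3 : (u : ℝ) ≤ L := by exact_mod_cast hu
    have h4 : (0 : ℝ) ≤ s := Nat.cast_nonneg s
    refine par_C e d s t u (8 * (L + 1) ^ 3) hd0 ?_ h1 h2 h4 ?_
    · nlinarith [mul_le_mul_of_nonneg_left hdL3 hd0.le]
    · calc ((t : ℝ) + s) * (u + s) * (u + t)
          ≤ (2 * (L + 1)) * (2 * (L + 1)) * (2 * (L + 1)) := by
            gcongr <;> linarith
        _ = _ := by ring
  have hCe : ∀ i s t u : ℕ, ori (X i s, X i s ^ 2 + e * s) (X i t, X i t ^ 2 + e * t)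
      (X i u, X i u ^ 2 + e * u) = - sg i * (d * ((t : ℝ) - s) * (u - s) * (u - t) *
        (e - d ^ 2 * (((t : ℝ) + s) * (u + s) * (u + t)))) := by
    intro i s t u
    have h3 : sg i ^ 3 = sg i := by simp only [sg]; split_ifs <;> norm_num
    rw [ori_par]
    have h4 : ((X i t - X i s) * (X i u - X i s) * (X i u - X i t)) = sg i ^ 3 * (d ^ 3 *
      ((t ^ 2 - s ^ 2) * (u ^ 2 - s ^ 2) * (u ^ 2 - t ^ 2))) := by simp only [X]; ring
    rw [h4, h3]
    simp only [X]; ring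
  refine ⟨fun i s => (X i s, X i s ^ 2 + e * s), ?_, ?_, ?_, ?_, ?_, ?_, ?_⟩
  · intro i j m s t u hij hjm hm hs ht hu
    rw [ori_par]
    have g1 := hgap i j s t hij hs ht
    have g2 := hgap j m t u hjm ht hu
    have h2 : (t : ℝ) ≤ L := by exact_mod_cast ht
    have h3 : (0 : ℝ) ≤ s := Nat.cast_nonneg s
    have h4 : (0 : ℝ) ≤ u := Nat.cast_nonneg u
    have hw : 0 < X m u - X i s := by linarith
    have k1 : 1 / 4 ≤ (X j t - X i s) * (X m u - X j t) := by nlinarith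
    have k2 : e * t ≤ 1 / 8 := by nlinarith
    have k3 : 0 ≤ e * (s * (X m u - X j t)) := mul_nonneg he0.le (mul_nonneg h3 (by linarith))
    have k4 : 0 ≤ e * (u * (X j t - X i s)) := mul_nonneg he0.le (mul_nonneg h4 (by linarith))
    have k5 := mul_le_mul_of_nonneg_right k1 hw.le
    have k6 := mul_le_mul_of_nonneg_right k2 hw.le
    nlinarith
  · intro i m s t u him hm hst ht hu
    rw [ori_par]
    have hs : s ≤ L := by omega
    have hc := hclose i s t hst ht
    refine par_B e (N + 1) L _ _ _ s t u he0 (by positivity) hL ?_ ?_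
      (hgap i m s u him hs hu) (hup i m t u him hm ht hu) (by linarith [hgap i m t u him ht hu])
      (by exact_mod_cast hst) (hdiff s u hs hu)
    · exact le_trans (by gcongr) hdM
    · exact le_trans (by gcongr) hdL
  · intro i m s t u him hm hst ht hu
    rw [ori_par]
    have hs : s ≤ L := by omega
    have hc := hclose i s t hst ht
    have hc' : |(-X i t) - (-X i s)| ≤ d * L ^ 2 := by
      rw [show (-X i t) - (-X i s) = -(X i t - X i s) by ring, abs_neg]; exact hc
    have := par_B e (N + 1) L (- X i s) (- X i t) (- X m u) s t u he0 (by positivity) hL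
      (le_trans (by gcongr) hdM) (le_trans (by gcongr) hdL)
      (by linarith [hgap m i u s him hu hs]) (by linarith [hup m i u t him hm hu ht])
      (by linarith [hgap m i u t him hu ht])
      (by exact_mod_cast hst) (hdiff s u hs hu)
    linarith
  · intro i s t u hi hst htu hu hT
    rw [hCe, show sg i = -1 by simp [sg, hT]]
    have := hCC i s t u hst htu hu
    linarith
  · intro i s t u hi hst htu hu hT
    rw [hCe, show sg i = 1 by simp [sg, hT]]
    have := hCC i s t u hst htu hu
    linarith
  · intro i j s t hij hj hs ht
    have := hgap i j s t hij hs ht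
    linarith
  · intro i s t hst ht heq
    have h1 := congrArg Prod.fst heq
    have h2 := congrArg Prod.snd heq
    simp only at h1 h2
    rw [h1] at h2
    have h3 : (s : ℝ) < t := by exact_mod_cast hst
    nlinarith [mul_lt_mul_of_pos_left h3 he0]

lemma three_sorted (A : Finset ℕ) (h : 3 ≤ A.card) :
    ∃ s ∈ A, ∃ t ∈ A, ∃ u ∈ A, s < t ∧ t < u := by
  refine ⟨A.orderEmbOfFin rfl ⟨0, by omega⟩, Finset.orderEmbOfFin_mem _ _ _,
    A.orderEmbOfFin rfl ⟨1, by omega⟩, Finset.orderEmbOfFin_mem _ _ _,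
    A.orderEmbOfFin rfl ⟨2, by omega⟩, Finset.orderEmbOfFin_mem _ _ _, ?_, ?_⟩ <;>
  · rw [OrderEmbedding.lt_iff_lt]; simp

lemma two_sorted (A : Finset ℕ) (h : 2 ≤ A.card) : ∃ s ∈ A, ∃ t ∈ A, s < t := by
  refine ⟨A.orderEmbOfFin rfl ⟨0, by omega⟩, Finset.orderEmbOfFin_mem _ _ _,
    A.orderEmbOfFin rfl ⟨1, by omega⟩, Finset.orderEmbOfFin_mem _ _ _, ?_⟩
  rw [OrderEmbedding.lt_iff_lt]; simp

/-- The index set: clusters `0` and `n + 1` are singletons, the others have `L + 1` points. -/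
def idx (n L : ℕ) : Finset (ℕ × ℕ) :=
  {(0, 0), (n + 1, 0)} ∪ Finset.Icc 1 n ×ˢ Finset.range (L + 1)

lemma mem_idx (n L : ℕ) (a : ℕ × ℕ) : a ∈ idx n L ↔
    a.1 ≤ n + 1 ∧ a.2 ≤ L ∧ (a.1 = 0 → a.2 = 0) ∧ (a.1 = n + 1 → a.2 = 0) := by
  obtain ⟨i, s⟩ := a
  simp only [idx, Finset.mem_union, Finset.mem_insert, Finset.mem_singleton, Prod.mk.injEq,
    Finset.mem_product, Finset.mem_Icc, Finset.mem_range]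
  omega

lemma card_idx (n L : ℕ) : (idx n L).card = n * (L + 1) + 2 := by
  rw [idx, Finset.card_union_of_disjoint]
  · rw [Finset.card_product, Finset.card_pair (by simp)]
    simp; ring
  · rw [Finset.disjoint_left]
    rintro ⟨i, s⟩
    simp only [Finset.mem_insert, Finset.mem_singleton, Prod.mk.injEq,
      Finset.mem_product, Finset.mem_Icc, Finset.mem_range]
    omega

lemma Cfg.card_bound {n L : ℕ} {P : ℕ → ℕ → Pt} (hL : 2 * L ≤ n + 2)
    (h : Cfg (n + 1) L (fun i => 2 * (i + 1) ≤ n + 3) P) (H : Set Pt) (hH : ConvexPos H)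
    (G : Finset (ℕ × ℕ)) (hG : G ⊆ idx n L) (hGH : ∀ a ∈ G, P a.1 a.2 ∈ H) :
    G.card ≤ n + 2 := by
  classical
  rcases G.eq_empty_or_nonempty with rfl | hne
  · simp
  have hI : ∀ i s, (i, s) ∈ G → i ≤ n + 1 ∧ s ≤ L ∧ (i = 0 → s = 0) ∧ (i = n + 1 → s = 0) :=
    fun i s hs => (mem_idx n L (i, s)).1 (hG hs)
  let A : ℕ → Finset ℕ := fun i => (G.filter (fun a => a.1 = i)).image Prod.snd
  have hmemA : ∀ i s, s ∈ A i ↔ (i, s) ∈ G := by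
    intro i s
    simp only [A, Finset.mem_image, Finset.mem_filter, Prod.exists]
    constructor
    · rintro ⟨a, b, ⟨h1, rfl⟩, rfl⟩; exact h1
    · intro h1; exact ⟨i, s, ⟨h1, rfl⟩, rfl⟩
  have hcardA : ∀ i, (G.filter (fun a => a.1 = i)).card = (A i).card := by
    intro i
    refine (Finset.card_image_of_injOn ?_).symm
    rintro ⟨a, b⟩ h1 ⟨c, d⟩ h2 h3
    simp only [Finset.coe_filter, mem_ofPred_eq] at h1 h2 h3
    simp [h1.2, h2.2, h3]
  have hA1 : ∀ i, (A i).card ≤ L + 1 := by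
    intro i
    have : A i ⊆ Finset.range (L + 1) := by
      intro s hs
      have := hI i s ((hmemA i s).1 hs)
      simp; omega
    simpa using Finset.card_le_card this
  have hA0 : ∀ i, i = 0 ∨ i = n + 1 → (A i).card ≤ 1 := by
    intro i hi
    have : A i ⊆ {0} := by
      intro s hs
      have := hI i s ((hmemA i s).1 hs)
      simp; omega
    simpa using Finset.card_le_card this
  obtain ⟨⟨i, si⟩, hi, himin⟩ := G.exists_min_image Prod.fst hne
  obtain ⟨⟨j, sj⟩, hj, hjmax⟩ := G.exists_max_image Prod.fst hne
  simp only at himin hjmax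
  have hiI := hI i si hi
  have hjI := hI j sj hj
  have hij : i ≤ j := himin _ hj
  rcases hij.eq_or_lt with rfl | hlt
  · have : G = G.filter (fun a => a.1 = i) := by
      ext a
      simp only [Finset.mem_filter, iff_self_and]
      intro ha
      exact le_antisymm (hjmax a ha) (himin a ha)
    rw [this, hcardA]
    by_cases hi0 : i = 0 ∨ i = n + 1
    · have := hA0 i hi0; omega
    · have := hA1 i; omega
  have hmid : (G.filter (fun a => i < a.1 ∧ a.1 < j)).card ≤ j - i - 1 := by
    have : (G.filter (fun a => i < a.1 ∧ a.1 < j)).card ≤ (Finset.Ioo i j).card := by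
      refine Finset.card_le_card_of_injOn Prod.fst ?_ ?_
      · intro a ha
        simpa using (Finset.mem_filter.1 ha).2
      · rintro ⟨a, b⟩ h1 ⟨c, d⟩ h2 h3
        simp only [Finset.coe_filter, mem_ofPred_eq] at h1 h2 h3
        subst h3
        obtain ⟨h1, h1'⟩ := h1
        obtain ⟨h2, _⟩ := h2
        have b1 := hI _ _ h1
        have b2 := hI _ _ h2
        rcases lt_trichotomy b d with hbd | hbd | hbd
        · exact (h.two H hH i a j si b d sj h1'.1 h1'.2 hjI.1 hbd hiI.2.1 b2.2.1 hjI.2.1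
            (hGH _ hi) (hGH _ h1) (hGH _ h2) (hGH _ hj)).elim
        · rw [hbd]
        · exact (h.two H hH i a j si d b sj h1'.1 h1'.2 hjI.1 hbd hiI.2.1 b1.2.1 hjI.2.1
            (hGH _ hi) (hGH _ h2) (hGH _ h1) (hGH _ hj)).elim
    simpa using this
  have htot : G.card ≤ (A i).card + (A j).card + (j - i - 1) := by
    have hsub : G ⊆ (G.filter (fun a => a.1 = i) ∪ G.filter (fun a => a.1 = j)) ∪
        G.filter (fun a => i < a.1 ∧ a.1 < j) := by
      intro a ha
      have h1 := himin a ha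
      have h2 := hjmax a ha
      simp only [Finset.mem_union, Finset.mem_filter, ha, true_and]
      omega
    have h1 := Finset.card_le_card hsub
    have h2 := Finset.card_union_le (G.filter (fun a => a.1 = i) ∪ G.filter (fun a => a.1 = j))
      (G.filter (fun a => i < a.1 ∧ a.1 < j))
    have h3 := Finset.card_union_le (G.filter (fun a => a.1 = i)) (G.filter (fun a => a.1 = j))
    rw [hcardA, hcardA] at h3
    omega
  have hleft : 2 * (i + 1) ≤ n + 3 → (A i).card ≤ 1 + i := by
    intro hT
    by_cases hi0 : i = 0
    · have := hA0 i (Or.inl hi0); omega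
    by_contra hcon
    obtain ⟨s, hs, t, ht, u, hu, hst, htu⟩ := three_sorted (A i) (by omega)
    rw [hmemA] at hs ht hu
    exact h.three H hH i j s t u sj hlt hjI.1 hst htu (hI _ _ hu).2.1 hjI.2.1 hT
      (hGH _ hs) (hGH _ ht) (hGH _ hu) (hGH _ hj)
  have hright : ¬ 2 * (j + 1) ≤ n + 3 → (A j).card ≤ 1 + (n + 1 - j) := by
    intro hT
    by_cases hj0 : j = n + 1
    · have := hA0 j (Or.inr hj0); omega
    by_contra hcon
    obtain ⟨s, hs, t, ht, u, hu, hst, htu⟩ := three_sorted (A j) (by omega)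
    rw [hmemA] at hs ht hu
    exact h.three' H hH j i s t u si hlt hjI.1 hst htu (hI _ _ hu).2.1 hiI.2.1 hT
      (hGH _ hs) (hGH _ ht) (hGH _ hu) (hGH _ hi)
  have hi1 := hA1 i
  have hj1 := hA1 j
  by_cases hTi : 2 * (i + 1) ≤ n + 3 <;> by_cases hTj : 2 * (j + 1) ≤ n + 3
  · have := hleft hTi; omega
  · have := hleft hTi; have := hright hTj; omega
  · omega
  · have := hright hTj; omega

/-- The point set of a configuration. -/
def ptSet (n L : ℕ) (P : ℕ → ℕ → Pt) : Set Pt :=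
  (fun a : ℕ × ℕ => P a.1 a.2) '' (idx n L : Set (ℕ × ℕ))

lemma Cfg.injOn {n L : ℕ} {T : ℕ → Prop} {P : ℕ → ℕ → Pt} (h : Cfg (n + 1) L T P) :
    Set.InjOn (fun a : ℕ × ℕ => P a.1 a.2) (idx n L : Set (ℕ × ℕ)) := by
  intro a ha b hb hab
  have ha := (mem_idx n L a).1 ha
  have hb := (mem_idx n L b).1 hb
  have := h.inj _ _ _ _ ha.1 hb.1 ha.2.1 hb.2.1 hab
  exact Prod.ext this.1 this.2

lemma Cfg.sorted_count {n L : ℕ} {T : ℕ → Prop} {P : ℕ → ℕ → Pt} (h : Cfg (n + 1) L T P)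
    (a b c : ℕ × ℕ) (ha : a ∈ idx n L) (hb : b ∈ idx n L) (hc : c ∈ idx n L)
    (hab : a.1 ≤ b.1) (hbc : b.1 ≤ c.1) (K : Set Pt)
    (hK : K = {P a.1 a.2, P b.1 b.2, P c.1 c.2}) :
    (ptSet n L P ∩ interior (convexHull ℝ K)).ncard ≤ L := by
  classical
  have ha := (mem_idx n L a).1 ha
  have hb := (mem_idx n L b).1 hb
  have hc := (mem_idx n L c).1 hc
  have hsub : ptSet n L P ∩ interior (convexHull ℝ K) ⊆
      ((((Finset.range (L + 1)).erase b.2).image (fun s => P b.1 s) : Finset Pt) : Set Pt) := by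
    rintro q ⟨⟨⟨i, s⟩, hq, rfl⟩, hint⟩
    have hq := (mem_idx n L _).1 hq
    simp only at hq hint
    rw [hK] at hint
    have hi := h.median i a.1 b.1 c.1 s a.2 b.2 c.2 hab hbc hc.1 hq.1 hq.2.1 ha.2.1 hb.2.1
      hc.2.1 hint
    subst hi
    simp only [Finset.coe_image, Finset.coe_erase]
    refine ⟨s, ⟨by simp; omega, ?_⟩, rfl⟩
    simp only [mem_singleton_iff]
    rintro rfl
    rw [Set.insert_comm] at hint
    exact interior_ne _ _ _ _ hint rfl
  refine (Set.ncard_le_ncard hsub (Finset.finite_toSet _)).trans ?_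
  rw [Set.ncard_coe_finset]
  refine Finset.card_image_le.trans ?_
  rw [Finset.card_erase_of_mem (by simp; omega)]
  simp

/-- for `ℓ < k/2` there is an `ℓ`-convex set of `(k-3)(ℓ+1)+2` points
in general position with no `k` points in convex position. -/
theorem statement_16 (k lam : ℕ) (hk : 3 ≤ k) (hlam : 2 * lam < k) :
    ∃ S : Set Pt, S.Finite ∧ GenPos S ∧ LambdaConvex lam S ∧
      S.ncard = (k - 3) * (lam + 1) + 2 ∧
      ¬ ∃ H ⊆ S, H.ncard = k ∧ ConvexPos H := by
  classical
  obtain ⟨n, rfl⟩ : ∃ n, k = n + 3 := ⟨k - 3, by omega⟩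
  obtain ⟨P, h⟩ := exists_cfg (n + 1) lam (fun i => 2 * (i + 1) ≤ n + 3)
  refine ⟨ptSet n lam P, (Finset.finite_toSet _).image _, ?_, ?_, ?_, ?_⟩
  · rintro _ ⟨a, ha, rfl⟩ _ ⟨b, hb, rfl⟩ _ ⟨c, hc, rfl⟩ hab hac hbc hcol
    have ha := (mem_idx n lam a).1 ha
    have hb := (mem_idx n lam b).1 hb
    have hc := (mem_idx n lam c).1 hc
    refine h.ori_ne a b c ?_ ?_ ?_ ha.1 hb.1 hc.1 ha.2.1 hb.2.1 hc.2.1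
      (ori_of_collinear _ _ _ hcol)
    · rintro rfl; exact hab rfl
    · rintro rfl; exact hbc rfl
    · rintro rfl; exact hac rfl
  · rintro _ ⟨a, ha, rfl⟩ _ ⟨b, hb, rfl⟩ _ ⟨c, hc, rfl⟩
    rcases le_total a.1 b.1 with h1 | h1 <;> rcases le_total b.1 c.1 with h2 | h2 <;>
      rcases le_total a.1 c.1 with h3 | h3
    · exact h.sorted_count a b c ha hb hc h1 h2 _ rfl
    · exact h.sorted_count a b c ha hb hc h1 h2 _ rfl
    · exact h.sorted_count a c b ha hc hb h3 h2 _
        (by ext; simp only [mem_insert_iff, mem_singleton_iff]; tauto)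
    · exact h.sorted_count c a b hc ha hb h3 h1 _
        (by ext; simp only [mem_insert_iff, mem_singleton_iff]; tauto)
    · exact h.sorted_count b a c hb ha hc h1 h3 _
        (by ext; simp only [mem_insert_iff, mem_singleton_iff]; tauto)
    · exact h.sorted_count b c a hb hc ha h2 h3 _
        (by ext; simp only [mem_insert_iff, mem_singleton_iff]; tauto)
    · exact h.sorted_count c b a hc hb ha h2 h1 _
        (by ext; simp only [mem_insert_iff, mem_singleton_iff]; tauto)
    · exact h.sorted_count c b a hc hb ha h2 h1 _
        (by ext; simp only [mem_insert_iff, mem_singleton_iff]; tauto)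
  · rw [ptSet, Set.ncard_image_of_injOn h.injOn, Set.ncard_coe_finset, card_idx]
    simp
  · rintro ⟨H, hHS, hcard, hH⟩
    let G : Finset (ℕ × ℕ) := (idx n lam).filter (fun a => P a.1 a.2 ∈ H)
    have hHG : H = (fun a : ℕ × ℕ => P a.1 a.2) '' (G : Set (ℕ × ℕ)) := by
      ext q
      constructor
      · intro hq
        obtain ⟨a, ha, rfl⟩ := hHS hq
        exact ⟨a, Finset.mem_coe.2 (Finset.mem_filter.2 ⟨ha, hq⟩), rfl⟩
      · rintro ⟨a, ha, rfl⟩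
        exact (Finset.mem_filter.1 (Finset.mem_coe.1 ha)).2
    have hle := h.card_bound (by omega) H hH G (Finset.filter_subset _ _)
      (fun a ha => (Finset.mem_filter.1 ha).2)
    have : H.ncard ≤ G.card := by
      rw [hHG, ← Set.ncard_coe_finset G]
      exact Set.ncard_image_le (Finset.finite_toSet _)
    omega
end
end
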